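/- If Y ⊆ ℝ² is a Borel set with dim_H Y ≤ 1, then the set of points x ∈ ℝ² \ Y such that dim_H π_x(Y) < dim_H Y has Hausdorff dimension at most 1. -/

import Mathlib

open Metric MeasureTheory Set
open scoped ENNReal NNReal RealInnerProductSpace

noncomputable section

abbrev E2 := EuclideanSpace ℝ (Fin 2)

/-- Radial projection `π_x(y) = (y-x)/|y-x|`. -/
def radProj {E : Type*} [NormedAddCommGroup E] [NormedSpace ℝ E] (x y : E) : E :=
  ‖y - x‖⁻¹ • (y - x)

/-- A subset of a real vector space is an affine line. -/
def IsAffineLine {E : Type*} [AddCommGroup E] [Module ℝ E] (ℓ : Set E) : Prop :=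
  ∃ a v : E, v ≠ 0 ∧ ℓ = {p | ∃ t : ℝ, p = a + t • v}

/-- The (topological) support of a measure. -/
def msupport {E : Type*} [PseudoMetricSpace E] [MeasurableSpace E] (μ : Measure E) : Set E :=
  {x | ∀ r : ℝ, 0 < r → 0 < μ (ball x r)}

/-- `(μ,ν)` has `(t,K,c)`-thin tubes. -/
def ThinTubesWith (μ ν : Measure E2) (t K c : ℝ) : Prop :=
  ∃ G : Set (E2 × E2), MeasurableSet G ∧ G ⊆ (msupport μ) ×ˢ (msupport ν) ∧
    ENNReal.ofReal c ≤ (μ.prod ν) G ∧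
    ∀ x ∈ msupport μ, ∀ r : ℝ, 0 < r → ∀ ℓ : Set E2, IsAffineLine ℓ →
      x ∈ cthickening r ℓ →
      ν (cthickening r ℓ ∩ {y | (x, y) ∈ G}) ≤ ENNReal.ofReal (K * r ^ t)

/-- `(μ,ν)` has `t`-thin tubes. -/
def ThinTubes (μ ν : Measure E2) (t : ℝ) : Prop :=
  ∃ K c : ℝ, 0 < K ∧ 0 < c ∧ ThinTubesWith μ ν t K c

/-! ### An oscillating kernel on lines -/

/-- The mean-zero profile `1_{[-2,2]} - K⁻¹ 1_{[-2K,2K]}`. -/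
def oscProfile (K v : ℝ) : ℝ :=
  (Icc (-2) 2).indicator (fun _ => (1 : ℝ)) v -
    K⁻¹ * (Icc (-(2 * K)) (2 * K)).indicator (fun _ => (1 : ℝ)) v

lemma measurable_oscProfile (K : ℝ) : Measurable (oscProfile K) :=
  (measurable_const.indicator measurableSet_Icc).sub
    ((measurable_const.indicator measurableSet_Icc).const_mul _)

lemma integrable_indicator_Icc_one (a b : ℝ) :
    Integrable ((Icc a b).indicator (fun _ => (1 : ℝ))) := by
  rw [integrable_indicator_iff measurableSet_Icc]
  exact integrableOn_const (by simp) (by simp)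

lemma integrable_oscProfile (K : ℝ) : Integrable (oscProfile K) :=
  (integrable_indicator_Icc_one _ _).sub ((integrable_indicator_Icc_one _ _).const_mul _)

lemma integral_oscProfile {K : ℝ} (hK : 1 ≤ K) : ∫ v, oscProfile K v = 0 := by
  unfold oscProfile
  rw [integral_sub (integrable_indicator_Icc_one _ _)
    ((integrable_indicator_Icc_one _ _).const_mul _), integral_const_mul,
    integral_indicator measurableSet_Icc, integral_indicator measurableSet_Icc]
  simp only [integral_const, MeasurableSet.univ, measureReal_restrict_apply, univ_inter,
    Real.volume_real_Icc, smul_eq_mul, mul_one]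
  rw [max_eq_left (by linarith), max_eq_left (by linarith)]
  field_simp
  ring

lemma abs_oscProfile_le {K : ℝ} (hK : 1 ≤ K) (v : ℝ) : |oscProfile K v| ≤ 1 := by
  have h1 : K⁻¹ ≤ 1 := inv_le_one_of_one_le₀ hK
  have h0 : 0 ≤ K⁻¹ := by positivity
  unfold oscProfile indicator
  split_ifs <;> rw [abs_le] <;> constructor <;> linarith

lemma oscProfile_eq_zero {K v : ℝ} (hK : 1 ≤ K) (hv : 2 * K < |v|) : oscProfile K v = 0 := by
  have h1 : v ∉ Icc (-(2 * K)) (2 * K) := fun h => by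
    have := abs_le.2 h; linarith
  have h2 : v ∉ Icc (-2 : ℝ) 2 := fun h => by
    have := abs_le.2 h; linarith
  simp [oscProfile, h1, h2]

lemma oscProfile_neg (K v : ℝ) : oscProfile K (-v) = oscProfile K v := by
  have h : ∀ c : ℝ, (-v ∈ Icc (-c) c) = (v ∈ Icc (-c) c) := fun c => by
    rw [mem_Icc, mem_Icc, ← abs_le, ← abs_le, abs_neg]
  simp only [oscProfile, indicator, h]

/-- The self-convolution of `oscProfile`. -/
def oscConv (K v : ℝ) : ℝ := ∫ s, oscProfile K s * oscProfile K (v - s)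

lemma integral_eq_zero_off_Icc {f : ℝ → ℝ} {R P : ℝ} (hR : 0 ≤ R)
    (hf : ∀ v, |f v| ≤ P) (h0 : ∀ v, R < |v| → f v = 0) : |∫ v, f v| ≤ 2 * R * P := by
  rw [← setIntegral_eq_integral_of_forall_compl_eq_zero (s := Icc (-R) R)]
  · have := norm_setIntegral_le_of_norm_le_const (μ := volume) (s := Icc (-R) R) (f := f)
      (C := P) (by simp) (fun v _ => by simpa using hf v)
    rw [Real.norm_eq_abs, Real.volume_real_Icc, max_eq_left (by linarith)] at this
    linarith
  · intro v hv
    refine h0 v (lt_of_not_ge fun h => hv (abs_le.1 h))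

lemma measurable_oscConv (K : ℝ) : Measurable (oscConv K) := by
  have h : StronglyMeasurable (Function.uncurry fun v s : ℝ =>
      oscProfile K s * oscProfile K (v - s)) := by
    apply Measurable.stronglyMeasurable
    exact ((measurable_oscProfile K).comp measurable_snd).mul
      ((measurable_oscProfile K).comp (measurable_fst.sub measurable_snd))
  exact h.integral_prod_right.measurable

lemma abs_oscConv_le {K : ℝ} (hK : 1 ≤ K) (v : ℝ) : |oscConv K v| ≤ 4 * K := by
  have := integral_eq_zero_off_Icc (f := fun s => oscProfile K s * oscProfile K (v - s))
    (R := 2 * K) (P := 1) (by linarith) ?_ ?_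
  · unfold oscConv; linarith
  · intro s
    rw [abs_mul]
    exact mul_le_one₀ (abs_oscProfile_le hK _) (abs_nonneg _) (abs_oscProfile_le hK _)
  · intro s hs
    simp [oscProfile_eq_zero hK hs]

lemma oscConv_eq_zero {K v : ℝ} (hK : 1 ≤ K) (hv : 4 * K < |v|) : oscConv K v = 0 := by
  unfold oscConv
  have : ∀ s, oscProfile K s * oscProfile K (v - s) = 0 := by
    intro s
    by_cases hs : 2 * K < |s|
    · simp [oscProfile_eq_zero hK hs]
    · rw [oscProfile_eq_zero hK (v := v - s), mul_zero]
      have := abs_sub_abs_le_abs_sub v s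
      linarith
  simp [this]

lemma integral_oscConv {K : ℝ} (hK : 1 ≤ K) : ∫ v, oscConv K v = 0 := by
  have := integral_convolution (μ := volume) (ν := volume) (ContinuousLinearMap.mul ℝ ℝ)
    (integrable_oscProfile K) (integrable_oscProfile K)
  simp only [convolution, ContinuousLinearMap.mul_apply', integral_oscProfile hK, mul_zero] at this
  exact this

lemma integral_oscProfile_mul {K r : ℝ} (hr : 0 < r) (c c' : ℝ) :
    ∫ b, oscProfile K ((c - b) / r) * oscProfile K ((c' - b) / r) =
      r * oscConv K ((c - c') / r) := by
  have h1 : ∀ b, oscProfile K ((c - b) / r) * oscProfile K ((c' - b) / r) =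
      (fun t => (fun s => oscProfile K s * oscProfile K ((c - c') / r - s)) (t / r)) (c - b) := by
    intro b
    simp only
    rw [← oscProfile_neg K ((c' - b) / r)]
    congr 2
    field_simp
    ring
  simp_rw [h1]
  rw [integral_sub_left_eq_self
      (fun t => (fun s => oscProfile K s * oscProfile K ((c - c') / r - s)) (t / r)) volume c,
    Measure.integral_comp_div (fun s => oscProfile K s * oscProfile K ((c - c') / r - s)),
    abs_of_pos hr]
  rfl

/-- A `1`-Lipschitz cutoff equal to `1` on `[-L,L]` and supported in `[-(L+1), L+1]`. -/
def tentCutoff (L a : ℝ) : ℝ := max 0 (min 1 (L + 1 - |a|))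

lemma tentCutoff_nonneg (L a : ℝ) : 0 ≤ tentCutoff L a := le_max_left _ _

lemma tentCutoff_le_one (L a : ℝ) : tentCutoff L a ≤ 1 := max_le zero_le_one (min_le_left _ _)

lemma tentCutoff_eq_one {L a : ℝ} (h : |a| ≤ L) : tentCutoff L a = 1 := by
  rw [tentCutoff, min_eq_left (by linarith), max_eq_right zero_le_one]

lemma tentCutoff_eq_zero {L a : ℝ} (h : L + 1 ≤ |a|) : tentCutoff L a = 0 := by
  rw [tentCutoff, max_eq_left]
  exact (min_le_right _ _).trans (by linarith)

lemma continuous_tentCutoff (L : ℝ) : Continuous (tentCutoff L) := by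
  unfold tentCutoff; fun_prop

lemma abs_tentCutoff_sub_le (L a b : ℝ) : |tentCutoff L a - tentCutoff L b| ≤ |a - b| := by
  unfold tentCutoff
  refine (abs_max_sub_max_le_max _ _ _ _).trans ?_
  rw [sub_self, abs_zero, max_eq_right (abs_nonneg _)]
  refine (abs_min_sub_min_le_max _ _ _ _).trans ?_
  rw [sub_self, abs_zero, max_eq_right (abs_nonneg _)]
  have : L + 1 - |a| - (L + 1 - |b|) = |b| - |a| := by ring
  rw [this, abs_sub_comm a b]
  exact abs_abs_sub_abs_le _ _

lemma abs_integral_tentCutoff_mul_le {ψ : ℝ → ℝ} {P L : ℝ} (hL : 0 ≤ L) (hP : ∀ v, |ψ v| ≤ P)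
    (g : ℝ → ℝ) : |∫ a, tentCutoff L a * ψ (g a)| ≤ 2 * (L + 1) * P := by
  refine integral_eq_zero_off_Icc (by linarith) (fun a => ?_) (fun a ha => ?_)
  · rw [abs_mul, abs_of_nonneg (tentCutoff_nonneg _ _)]
    have := mul_le_mul (tentCutoff_le_one L a) (hP (g a)) (abs_nonneg _) zero_le_one
    linarith
  · rw [tentCutoff_eq_zero ha.le, zero_mul]

lemma abs_integral_tentCutoff_mul_osc_le {ψ : ℝ → ℝ} {P R L r d : ℝ} (e : ℝ)
    (hm : Measurable ψ) (hP : ∀ v, |ψ v| ≤ P) (hR : 0 ≤ R) (hz : ∀ v, R < |v| → ψ v = 0)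
    (hi : ∫ v, ψ v = 0) (hr : 0 < r) (hd : d ≠ 0) :
    |∫ a, tentCutoff L a * ψ ((e - a * d) / r)| ≤ (r / d) ^ 2 * (2 * R * (R * P)) := by
  have hP0 : 0 ≤ P := (abs_nonneg _).trans (hP 0)
  have hψ : Integrable ψ := by
    rw [← integrableOn_iff_integrable_of_support_subset (s := Icc (-R) R)]
    · exact IntegrableOn.of_bound (by simp) hm.aestronglyMeasurable P
        (Filter.Eventually.of_forall hP)
    · intro v hv
      by_contra h
      exact hv (hz v (lt_of_not_ge fun h' => h (abs_le.1 h')))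
  set g : ℝ → ℝ := fun v => tentCutoff L ((e - r * v) / d) * ψ v with hg
  have h1 : ∀ a, tentCutoff L a * ψ ((e - a * d) / r) =
      (fun t => g (e / r - t)) (a * (d / r)) := by
    intro a
    simp only [hg]
    congr 2 <;> field_simp
    ring
  simp_rw [h1]
  rw [Measure.integral_comp_mul_right (fun t => g (e / r - t)), integral_sub_left_eq_self g volume,
    smul_eq_mul, abs_mul, abs_abs]
  have h2 : ∫ v, g v = ∫ v, (tentCutoff L ((e - r * v) / d) - tentCutoff L (e / d)) * ψ v := by
    have : ∫ v, tentCutoff L (e / d) * ψ v = 0 := by rw [integral_const_mul, hi, mul_zero]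
    rw [← sub_zero (∫ v, g v), ← this, ← integral_sub]
    · congr 1; ext v; simp only [hg]; ring
    · refine hψ.bdd_mul (c := 1) ?_ (Filter.Eventually.of_forall fun v => ?_)
      · exact ((continuous_tentCutoff L).comp (by fun_prop)).aestronglyMeasurable
      · rw [Real.norm_eq_abs, abs_of_nonneg (tentCutoff_nonneg _ _)]
        exact tentCutoff_le_one _ _
    · exact hψ.const_mul _
  have h3 : |∫ v, g v| ≤ 2 * R * (|r / d| * R * P) := by
    rw [h2]
    refine integral_eq_zero_off_Icc hR (fun v => ?_) (fun v hv => by rw [hz v hv, mul_zero])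
    by_cases hv : R < |v|
    · rw [hz v hv, mul_zero, abs_zero]; positivity
    · rw [abs_mul]
      refine mul_le_mul ?_ (hP v) (abs_nonneg _) (by positivity)
      refine (abs_tentCutoff_sub_le _ _ _).trans ?_
      have : (e - r * v) / d - e / d = -((r / d) * v) := by ring
      rw [this, abs_neg, abs_mul]
      exact mul_le_mul_of_nonneg_left (not_lt.1 hv) (abs_nonneg _)
  calc |(d / r)⁻¹| * |∫ v, g v| ≤ |r / d| * (2 * R * (|r / d| * R * P)) := by
        rw [inv_div]; exact mul_le_mul_of_nonneg_left h3 (abs_nonneg _)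
    _ = |r / d| ^ 2 * (2 * R * (R * P)) := by ring
    _ = _ := by rw [sq_abs]

/-- Decay of the line kernel built from `oscConv`. -/
lemma exists_lineKernel_bound {K L : ℝ} (hK : 1 ≤ K) (hL : 0 ≤ L) :
    ∃ C : ℝ, 1 ≤ C ∧ ∀ r d e : ℝ, 0 < r →
      |∫ a, tentCutoff L a * oscConv K ((e - a * d) / r)| ≤ C ∧
      ∀ ρ : ℝ, 0 < ρ → (ρ ≤ |d| ∨ ρ ≤ |e|) →
        |∫ a, tentCutoff L a * oscConv K ((e - a * d) / r)| ≤ C * (r / ρ) ^ 2 := by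
  set P : ℝ := 4 * K
  set C₁ : ℝ := 2 * (L + 1) * P
  set M : ℝ := 4 * P * (L + 2)
  set C₂ : ℝ := 2 * P * (P * P)
  have hP : 4 ≤ P := by simp only [P]; linarith
  have hC₁ : 1 ≤ C₁ := by simp only [C₁]; nlinarith
  have hC₂ : 0 ≤ C₂ := by positivity
  have hM : 1 ≤ M := by simp only [M]; nlinarith
  have hb1 : ∀ r d e : ℝ, |∫ a, tentCutoff L a * oscConv K ((e - a * d) / r)| ≤ C₁ :=
    fun r d e => abs_integral_tentCutoff_mul_le hL (abs_oscConv_le hK) _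
  have hb2 : ∀ r d e : ℝ, 0 < r → d ≠ 0 →
      |∫ a, tentCutoff L a * oscConv K ((e - a * d) / r)| ≤ (r / d) ^ 2 * C₂ := fun r d e hr hd =>
    abs_integral_tentCutoff_mul_osc_le e (measurable_oscConv K) (abs_oscConv_le hK)
      (by positivity) (fun v => oscConv_eq_zero hK) (integral_oscConv hK) hr hd
  refine ⟨C₁ * M ^ 2 + C₂ * (2 * (L + 2)) ^ 2, ?_, fun r d e hr => ⟨?_, fun ρ hρ hor => ?_⟩⟩
  · have : 1 ≤ C₁ * M ^ 2 := one_le_mul_of_one_le_of_one_le hC₁ (one_le_pow₀ hM)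
    have : 0 ≤ C₂ * (2 * (L + 2)) ^ 2 := by positivity
    linarith
  · refine (hb1 r d e).trans ?_
    have : C₁ * 1 ≤ C₁ * M ^ 2 := by gcongr; exact one_le_pow₀ hM
    have : 0 ≤ C₂ * (2 * (L + 2)) ^ 2 := by positivity
    linarith
  rw [add_mul]
  by_cases h1 : ρ ≤ M * r
  · refine (hb1 r d e).trans ?_
    have h2 : 1 ≤ M ^ 2 * (r / ρ) ^ 2 := by
      rw [← mul_pow]
      apply one_le_pow₀
      rw [mul_div_assoc', le_div_iff₀ hρ]; linarith
    have : C₁ * 1 ≤ C₁ * (M ^ 2 * (r / ρ) ^ 2) := by gcongr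
    have : 0 ≤ C₂ * (2 * (L + 2)) ^ 2 * (r / ρ) ^ 2 := by positivity
    linarith
  push Not at h1
  have hpos : 0 ≤ C₁ * M ^ 2 * (r / ρ) ^ 2 := by positivity
  by_cases h2 : ρ ≤ 2 * (L + 2) * |d|
  · have hd : d ≠ 0 := by
      rintro rfl
      simp at h2; linarith
    refine (hb2 r d e hr hd).trans ?_
    have h3 : (r / d) ^ 2 ≤ (2 * (L + 2)) ^ 2 * (r / ρ) ^ 2 := by
      rw [← sq_abs, ← mul_pow]
      apply pow_le_pow_left₀ (abs_nonneg _)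
      rw [abs_div, abs_of_pos hr, mul_div_assoc', div_le_div_iff₀ (abs_pos.2 hd) hρ]
      nlinarith
    nlinarith
  push Not at h2
  have hzero : ∀ a, tentCutoff L a * oscConv K ((e - a * d) / r) = 0 := by
    intro a
    by_cases ha : L + 1 ≤ |a|
    · rw [tentCutoff_eq_zero ha, zero_mul]
    push Not at ha
    have he : ρ ≤ |e| := by
      rcases hor with h | h
      · have := abs_nonneg d; nlinarith
      · exact h
    rw [oscConv_eq_zero hK, mul_zero]
    rw [abs_div, abs_of_pos hr, lt_div_iff₀ hr]
    have h4 := abs_sub_abs_le_abs_sub e (a * d)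
    rw [abs_mul] at h4
    have h5 : |a| * |d| ≤ (L + 2) * |d| := by
      apply mul_le_mul_of_nonneg_right _ (abs_nonneg _); linarith
    have h6 : 4 * K * r * 4 * 2 ≤ M * r := by
      simp only [M, P]; nlinarith [mul_pos hr (show 0 < K by linarith),
        mul_nonneg (mul_pos hr (show 0 < K by linarith)).le hL]
    nlinarith
  simp only [hzero, integral_zero, abs_zero]
  positivity

/-! ### Dyadic powers and finite masses -/

/-- `dyad τ j = 2 ^ (-τ j)`. -/
def dyad (τ : ℝ) (j : ℕ) : ℝ := ((2 : ℝ) ^ (-τ)) ^ j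

lemma dyad_pos (τ : ℝ) (j : ℕ) : 0 < dyad τ j := by unfold dyad; positivity

lemma dyad_add (τ : ℝ) (i j : ℕ) : dyad τ (i + j) = dyad τ i * dyad τ j := pow_add _ _ _

lemma dyad_exp_add (τ σ : ℝ) (j : ℕ) : dyad (τ + σ) j = dyad τ j * dyad σ j := by
  unfold dyad
  rw [← mul_pow, ← Real.rpow_add two_pos]
  congr 2; ring

@[simp] lemma dyad_zero_right (τ : ℝ) : dyad τ 0 = 1 := pow_zero _

@[simp] lemma dyad_zero_left (j : ℕ) : dyad 0 j = 1 := by simp [dyad]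

lemma dyad_one (j : ℕ) : dyad 1 j = (1 / 2) ^ j := by
  unfold dyad; rw [Real.rpow_neg_one]; norm_num

lemma dyad_le_one {τ : ℝ} (hτ : 0 ≤ τ) (j : ℕ) : dyad τ j ≤ 1 :=
  pow_le_one₀ (by positivity) (Real.rpow_le_one_of_one_le_of_nonpos one_le_two (by linarith))

lemma dyad_anti_left {τ σ : ℝ} (h : τ ≤ σ) (j : ℕ) : dyad σ j ≤ dyad τ j :=
  pow_le_pow_left₀ (by positivity)
    (Real.rpow_le_rpow_of_exponent_le one_le_two (by linarith)) j

lemma dyad_anti_right {τ : ℝ} (hτ : 0 ≤ τ) {i j : ℕ} (h : i ≤ j) : dyad τ j ≤ dyad τ i :=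
  pow_le_pow_of_le_one (by positivity)
    (Real.rpow_le_one_of_one_le_of_nonpos one_le_two (by linarith)) h

lemma dyad_two (j : ℕ) : dyad 2 j = dyad 1 j ^ 2 := by
  rw [show (2 : ℝ) = 1 + 1 by norm_num, dyad_exp_add, sq]

lemma one_le_four_mul_dyad_one {τ : ℝ} (hτ : τ ≤ 2) : 1 ≤ 4 * dyad τ 1 := by
  have := dyad_anti_left hτ 1
  rw [dyad_two, dyad_one] at this
  linarith

open Classical in
/-- The `ν`-mass of the elements of `T` satisfying `P`. -/
def mass {α : Type*} (T : Finset α) (ν : α → ℝ) (P : α → Prop) : ℝ :=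
  ∑ z ∈ T, if P z then ν z else 0

section mass

variable {α : Type*} {T : Finset α} {ν : α → ℝ} {P Q : α → Prop}

lemma mass_nonneg (hν : ∀ z, 0 ≤ ν z) : 0 ≤ mass T ν P :=
  Finset.sum_nonneg fun z _ => by split_ifs <;> simp [hν]

lemma mass_mono (hν : ∀ z, 0 ≤ ν z) (h : ∀ z ∈ T, P z → Q z) : mass T ν P ≤ mass T ν Q := by
  refine Finset.sum_le_sum fun z hz => ?_
  have := hν z; have := h z hz
  split_ifs <;> simp_all

lemma mass_le_sum (hν : ∀ z, 0 ≤ ν z) : mass T ν P ≤ ∑ z ∈ T, ν z := by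
  refine Finset.sum_le_sum fun z hz => ?_
  have := hν z
  split_ifs <;> simp_all

lemma mass_eq_zero (h : ∀ z ∈ T, ¬ P z) : mass T ν P = 0 :=
  Finset.sum_eq_zero fun z hz => if_neg (h z hz)

lemma mass_true : mass T ν (fun _ => True) = ∑ z ∈ T, ν z := by simp [mass]

lemma mass_le_sum_of_cover {ι : Type*} (I : Finset ι) {R : ι → α → Prop} (hν : ∀ z, 0 ≤ ν z)
    (h : ∀ z ∈ T, P z → ∃ i ∈ I, R i z) : mass T ν P ≤ ∑ i ∈ I, mass T ν (R i) := by
  classical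
  unfold mass
  rw [Finset.sum_comm]
  refine Finset.sum_le_sum fun z hz => ?_
  have h0 : ∀ i ∈ I, (0 : ℝ) ≤ if R i z then ν z else 0 := fun i _ => by
    split_ifs <;> simp [hν]
  split_ifs with hP
  · obtain ⟨i, hi, hR⟩ := h z hz hP
    refine le_trans ?_ (Finset.single_le_sum h0 hi)
    rw [if_pos hR]
  · exact Finset.sum_nonneg h0

lemma mass_mul_const (c : ℝ) : mass T (fun z => ν z * c) P = mass T ν P * c := by
  unfold mass
  rw [Finset.sum_mul]
  refine Finset.sum_congr rfl fun z _ => ?_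
  split_ifs <;> simp

end mass

lemma mass_product {α β : Type*} (S : Finset α) (T : Finset β) (μ : α → ℝ) (ν : β → ℝ)
    (P : α × β → Prop) :
    mass (S ×ˢ T) (fun e => μ e.1 * ν e.2) P =
      ∑ x ∈ S, μ x * mass T ν (fun y => P (x, y)) := by
  unfold mass
  rw [Finset.sum_product]
  refine Finset.sum_congr rfl fun x _ => ?_
  rw [Finset.mul_sum]
  refine Finset.sum_congr rfl fun y _ => ?_
  split_ifs <;> simp

/-- Summation over dyadic shells against a Frostman weight. -/
lemma sum_mul_le_of_shells {α : Type*} {T : Finset α} {ν ρ f : α → ℝ} {τ C₀ F₀ : ℝ} {j : ℕ}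
    (hν : ∀ z, 0 ≤ ν z) (hτ : τ ≤ 2) (hF₀ : 0 ≤ F₀)
    (hball : ∀ i ≤ j, mass T ν (fun z => ρ z ≤ dyad 1 i) ≤ C₀ * dyad τ i)
    (htot : ∑ z ∈ T, ν z ≤ C₀) (hf₀ : ∀ z ∈ T, f z ≤ F₀)
    (hf : ∀ z ∈ T, ∀ i ≤ j, dyad 1 i ≤ ρ z → f z * dyad τ i ≤ F₀ * dyad τ j) :
    ∑ z ∈ T, ν z * f z ≤ (j + 2) * (4 * C₀ * F₀) * dyad τ j := by
  classical
  have hpt : ∀ z ∈ T, f z ≤ 4 * F₀ * dyad τ j *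
      (1 + ∑ i ∈ Finset.range (j + 1), if ρ z ≤ dyad 1 i then (dyad τ i)⁻¹ else 0) := by
    intro z hz
    have hnn : ∀ i ∈ Finset.range (j + 1),
        (0 : ℝ) ≤ if ρ z ≤ dyad 1 i then (dyad τ i)⁻¹ else 0 := fun i _ => by
      have := (dyad_pos τ i).le
      split_ifs <;> positivity
    have hj := dyad_pos τ j
    by_cases h0 : dyad 1 0 ≤ ρ z
    · have h1 := hf z hz 0 (Nat.zero_le _) h0
      rw [dyad_zero_right, mul_one] at h1
      refine h1.trans ?_
      have h2 := Finset.sum_nonneg hnn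
      have h3 : 0 ≤ F₀ * dyad τ j := by positivity
      nlinarith [mul_nonneg h3 h2]
    · push Not at h0
      set i := Nat.findGreatest (fun i => ρ z ≤ dyad 1 i) j with hi
      have hij : i ≤ j := Nat.findGreatest_le j
      have hiρ : ρ z ≤ dyad 1 i :=
        Nat.findGreatest_spec (P := fun i => ρ z ≤ dyad 1 i) (Nat.zero_le j) h0.le
      have hs : (dyad τ i)⁻¹ ≤
          1 + ∑ i ∈ Finset.range (j + 1), if ρ z ≤ dyad 1 i then (dyad τ i)⁻¹ else 0 := by
        have := Finset.single_le_sum hnn (Finset.mem_range.2 (Nat.lt_succ_of_le hij))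
        rw [if_pos hiρ] at this
        linarith
      refine le_trans ?_ (mul_le_mul_of_nonneg_left hs (by positivity))
      have hdi := dyad_pos τ i
      rw [← div_eq_mul_inv, le_div_iff₀ hdi]
      rcases hij.eq_or_lt with h | h
      · rw [h]
        have := mul_le_mul_of_nonneg_right (hf₀ z hz) hj.le
        nlinarith [mul_nonneg hF₀ hj.le]
      · have h4 : dyad 1 (i + 1) ≤ ρ z := by
          by_contra! h5
          exact Nat.findGreatest_is_greatest (P := fun i => ρ z ≤ dyad 1 i)
            (Nat.lt_succ_self i) h h5.le
        have h6 := hf z hz (i + 1) h h4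
        rw [dyad_add] at h6
        have h7 := one_le_four_mul_dyad_one hτ
        rcases le_or_gt 0 (f z) with h8 | h8
        · nlinarith [mul_le_mul_of_nonneg_left h7 (mul_nonneg h8 hdi.le)]
        · nlinarith [mul_neg_of_neg_of_pos h8 hdi, mul_nonneg hF₀ hj.le]
  calc ∑ z ∈ T, ν z * f z ≤ ∑ z ∈ T, ν z * (4 * F₀ * dyad τ j *
      (1 + ∑ i ∈ Finset.range (j + 1), if ρ z ≤ dyad 1 i then (dyad τ i)⁻¹ else 0)) :=
        Finset.sum_le_sum fun z hz => mul_le_mul_of_nonneg_left (hpt z hz) (hν z)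
    _ = 4 * F₀ * dyad τ j * (∑ z ∈ T, ν z +
          ∑ i ∈ Finset.range (j + 1), mass T ν (fun z => ρ z ≤ dyad 1 i) * (dyad τ i)⁻¹) := by
        have : ∑ i ∈ Finset.range (j + 1), mass T ν (fun z => ρ z ≤ dyad 1 i) * (dyad τ i)⁻¹ =
            ∑ z ∈ T, ν z *
              ∑ i ∈ Finset.range (j + 1), if ρ z ≤ dyad 1 i then (dyad τ i)⁻¹ else 0 := by
          unfold mass
          simp_rw [Finset.sum_mul, Finset.mul_sum]
          rw [Finset.sum_comm]
          refine Finset.sum_congr rfl fun z _ => Finset.sum_congr rfl fun i _ => ?_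
          split_ifs <;> simp
        rw [this, ← Finset.sum_add_distrib, Finset.mul_sum]
        exact Finset.sum_congr rfl fun z _ => by ring
    _ ≤ 4 * F₀ * dyad τ j * (C₀ + ∑ i ∈ Finset.range (j + 1), C₀) := by
        refine mul_le_mul_of_nonneg_left (add_le_add htot (Finset.sum_le_sum fun i hi => ?_))
          (by have := (dyad_pos τ j).le; positivity)
        rw [← div_eq_mul_inv, div_le_iff₀ (dyad_pos τ i)]
        exact hball i (Nat.lt_succ_iff.1 (Finset.mem_range.1 hi))
    _ = _ := by
        simp only [Finset.sum_const, Finset.card_range, nsmul_eq_mul]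
        push_cast; ring

/-! ### Weighted point configurations and thin tubes -/

section configuration

variable {α : Type*}

/-- The distance between two points in the coordinates `p`, `q`. -/
def coordDist (p q : α → ℝ) (x z : α) : ℝ := max |p z - p x| |q z - q x|

/-- The slope of the line through two points. -/
def lineSlope (p q : α → ℝ) (x y : α) : ℝ := (q y - q x) / (p y - p x)

/-- The vertical distance from `z` to the line through `x` and `y`. -/
def lineDev (p q : α → ℝ) (x y z : α) : ℝ := |q z - q x - lineSlope p q x y * (p z - p x)|

/-- Frostman weights up to scale `2 ^ (-k)` on two finite sets that are uniformly transversal to the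
vertical direction. -/
structure FrostmanPair (p q : α → ℝ) (S T : Finset α) (μ ν : α → ℝ) (L D C₀ u s : ℝ) (k : ℕ) :
    Prop where
  μ_nonneg : ∀ z, 0 ≤ μ z
  ν_nonneg : ∀ z, 0 ≤ ν z
  μ_sum : ∑ z ∈ S, μ z ≤ 1
  ν_sum : ∑ z ∈ T, ν z ≤ 1
  slope_le : ∀ x ∈ S, ∀ y ∈ T, |lineSlope p q x y| ≤ L
  ne : ∀ x ∈ S, ∀ y ∈ T, p x ≠ p y
  diam_left : ∀ x ∈ S, ∀ z ∈ S, |p z - p x| ≤ D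
  diam_cross : ∀ x ∈ S, ∀ z ∈ T, |p z - p x| ≤ D
  μ_ball : ∀ x ∈ S, ∀ i ≤ k, mass S μ (fun z => coordDist p q x z ≤ dyad 1 i) ≤ C₀ * dyad u i
  ν_ball : ∀ x ∈ T, ∀ i ≤ k, mass T ν (fun z => coordDist p q x z ≤ dyad 1 i) ≤ C₀ * dyad s i

end configuration

lemma integrable_oscProfile_mul {K r : ℝ} (hK : 1 ≤ K) (hr : 0 < r) (c c' : ℝ) :
    Integrable fun b => oscProfile K ((c - b) / r) * oscProfile K ((c' - b) / r) := by
  have h : Integrable fun b => oscProfile K ((c' - b) / r) :=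
    ((integrable_oscProfile K).comp_div hr.ne').comp_sub_left c'
  refine h.bdd_mul (c := 1) ?_ (Filter.Eventually.of_forall fun b => abs_oscProfile_le hK _)
  exact ((measurable_oscProfile K).comp
    ((measurable_const.sub measurable_id).div_const r)).aestronglyMeasurable

lemma integrable_tentCutoff_mul {ψ g : ℝ → ℝ} {P : ℝ} (L : ℝ) (hm : Measurable ψ)
    (hP : ∀ v, |ψ v| ≤ P) (hg : Measurable g) : Integrable fun a => tentCutoff L a * ψ (g a) := by
  have hw : Integrable (tentCutoff L) := by
    refine (continuous_tentCutoff L).integrable_of_hasCompactSupport ?_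
    refine HasCompactSupport.intro (isCompact_Icc (a := -(L + 1)) (b := L + 1)) fun a ha => ?_
    exact tentCutoff_eq_zero (le_of_lt (lt_of_not_ge fun h => ha (abs_le.1 h)))
  exact hw.mul_bdd (c := P) (hm.comp hg).aestronglyMeasurable
    (Filter.Eventually.of_forall fun a => hP _)

section lineSum

variable {α : Type*}

/-- The oscillating tube sum of a weight along the line of slope `a` and intercept `b`. -/
def oscLineSum (p q : α → ℝ) (S : Finset α) (μ : α → ℝ) (K r a b : ℝ) : ℝ :=
  ∑ x ∈ S, μ x * oscProfile K ((q x - a * p x - b) / r)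

lemma oscLineSum_sq (p q : α → ℝ) (S : Finset α) (μ : α → ℝ) (K r a b : ℝ) :
    oscLineSum p q S μ K r a b ^ 2 = ∑ x ∈ S, ∑ z ∈ S, μ x * μ z *
      (oscProfile K ((q x - a * p x - b) / r) * oscProfile K ((q z - a * p z - b) / r)) := by
  rw [oscLineSum, sq, Finset.sum_mul_sum]
  exact Finset.sum_congr rfl fun x _ => Finset.sum_congr rfl fun z _ => by ring

lemma integrable_oscLineSum_sq (p q : α → ℝ) (S : Finset α) (μ : α → ℝ) {K r : ℝ} (hK : 1 ≤ K)
    (hr : 0 < r) (a : ℝ) : Integrable fun b => oscLineSum p q S μ K r a b ^ 2 := by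
  simp_rw [oscLineSum_sq]
  exact integrable_finsetSum _ fun x _ => integrable_finsetSum _ fun z _ =>
    (integrable_oscProfile_mul hK hr _ _).const_mul _

lemma integral_oscLineSum_sq (p q : α → ℝ) (S : Finset α) (μ : α → ℝ) {K r : ℝ} (hK : 1 ≤ K)
    (hr : 0 < r) (a : ℝ) : ∫ b, oscLineSum p q S μ K r a b ^ 2 =
      ∑ x ∈ S, ∑ z ∈ S, μ x * μ z * (r * oscConv K ((q x - q z - a * (p x - p z)) / r)) := by
  simp_rw [oscLineSum_sq]
  rw [integral_finsetSum _ fun x _ => integrable_finsetSum _ fun z _ =>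
    (integrable_oscProfile_mul hK hr _ _).const_mul _]
  refine Finset.sum_congr rfl fun x _ => ?_
  rw [integral_finsetSum _ fun z _ => (integrable_oscProfile_mul hK hr _ _).const_mul _]
  refine Finset.sum_congr rfl fun z _ => ?_
  rw [integral_const_mul, integral_oscProfile_mul hr]
  congr 4
  ring

lemma integrable_tentCutoff_mul_oscConv {K : ℝ} (hK : 1 ≤ K) (L d e r : ℝ) :
    Integrable fun a => tentCutoff L a * oscConv K ((e - a * d) / r) :=
  integrable_tentCutoff_mul L (measurable_oscConv K) (abs_oscConv_le hK)
    (g := fun a => (e - a * d) / r)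
    ((measurable_const.sub (measurable_id.mul_const d)).div_const r)

lemma tentCutoff_mul_integral_oscLineSum_sq (p q : α → ℝ) (S : Finset α) (μ : α → ℝ) {K r : ℝ}
    (hK : 1 ≤ K) (hr : 0 < r) (L a : ℝ) :
    tentCutoff L a * ∫ b, oscLineSum p q S μ K r a b ^ 2 =
      ∑ x ∈ S, ∑ z ∈ S, μ x * μ z * r *
        (tentCutoff L a * oscConv K ((q x - q z - a * (p x - p z)) / r)) := by
  rw [integral_oscLineSum_sq p q S μ hK hr, Finset.mul_sum]
  refine Finset.sum_congr rfl fun x _ => ?_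
  rw [Finset.mul_sum]
  exact Finset.sum_congr rfl fun z _ => by ring

lemma integrable_tentCutoff_mul_integral_oscLineSum_sq (p q : α → ℝ) (S : Finset α) (μ : α → ℝ)
    {K r : ℝ} (hK : 1 ≤ K) (hr : 0 < r) (L : ℝ) :
    Integrable fun a => tentCutoff L a * ∫ b, oscLineSum p q S μ K r a b ^ 2 := by
  simp_rw [tentCutoff_mul_integral_oscLineSum_sq p q S μ hK hr]
  exact integrable_finsetSum _ fun x _ => integrable_finsetSum _ fun z _ =>
    (integrable_tentCutoff_mul_oscConv hK _ _ _ _).const_mul _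

/-- The square mean over lines of the oscillating tube sums of a Frostman weight. -/
lemma exists_integral_oscLineSum_sq_le {K L : ℝ} (hK : 1 ≤ K) (hL : 0 ≤ L) :
    ∃ C : ℝ, 1 ≤ C ∧ ∀ {α : Type*} (p q : α → ℝ) (S : Finset α) (μ : α → ℝ) (C₀ u : ℝ) (j : ℕ),
      (∀ z, 0 ≤ μ z) → ∑ z ∈ S, μ z ≤ 1 → 1 ≤ C₀ → u ≤ 2 →
      (∀ x ∈ S, ∀ i ≤ j, mass S μ (fun z => coordDist p q x z ≤ dyad 1 i) ≤ C₀ * dyad u i) →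
      ∫ a, tentCutoff L a * ∫ b, oscLineSum p q S μ K (dyad 1 j) a b ^ 2 ≤
        C * C₀ * (j + 2) * dyad (u + 1) j := by
  obtain ⟨C, hC, hker⟩ := exists_lineKernel_bound hK hL
  refine ⟨4 * C, by linarith, fun p q S μ C₀ u j hμ hsum hC₀ hu hball => ?_⟩
  set r := dyad 1 j
  have hr : 0 < r := dyad_pos 1 j
  set J : _ → _ → ℝ := fun x z =>
    ∫ a, tentCutoff L a * oscConv K ((q x - q z - a * (p x - p z)) / r) with hJ
  have h1 : ∫ a, tentCutoff L a * ∫ b, oscLineSum p q S μ K r a b ^ 2 =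
      ∑ x ∈ S, μ x * (r * ∑ z ∈ S, μ z * J x z) := by
    simp_rw [tentCutoff_mul_integral_oscLineSum_sq p q S μ hK hr]
    rw [integral_finsetSum _ fun x _ => integrable_finsetSum _ fun z _ =>
      (integrable_tentCutoff_mul_oscConv hK _ _ _ _).const_mul _]
    refine Finset.sum_congr rfl fun x _ => ?_
    rw [integral_finsetSum _ fun z _ =>
      (integrable_tentCutoff_mul_oscConv hK _ _ _ _).const_mul _, Finset.mul_sum, Finset.mul_sum]
    refine Finset.sum_congr rfl fun z _ => ?_
    rw [integral_const_mul]
    ring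
  have h2 : ∀ x ∈ S, ∑ z ∈ S, μ z * J x z ≤ (j + 2) * (4 * C₀ * C) * dyad u j := by
    intro x hx
    refine sum_mul_le_of_shells (ρ := coordDist p q x) hμ hu (by linarith) (hball x hx)
      (hsum.trans hC₀) (fun z _ => (le_abs_self _).trans (hker r _ _ hr).1) fun z _ i hi hρ => ?_
    have h3 := (hker r (p x - p z) (q x - q z) hr).2 (dyad 1 i) (dyad_pos 1 i) (by
      rw [abs_sub_comm (p x), abs_sub_comm (q x)]; exact le_max_iff.1 hρ)
    obtain ⟨l, rfl⟩ := Nat.exists_eq_add_of_le hi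
    have h4 : r / dyad 1 i = dyad 1 l := by
      simp only [r, dyad_add]
      field_simp [(dyad_pos 1 i).ne']
    rw [h4, ← dyad_two] at h3
    have h5 := dyad_anti_left hu l
    rw [dyad_add]
    have h6 := dyad_pos u i
    calc J x z * dyad u i ≤ (C * dyad u l) * dyad u i := by
          refine mul_le_mul_of_nonneg_right ((le_abs_self _).trans (h3.trans ?_)) h6.le
          gcongr
      _ = _ := by ring
  rw [h1]
  calc ∑ x ∈ S, μ x * (r * ∑ z ∈ S, μ z * J x z)
      ≤ ∑ x ∈ S, μ x * (r * ((j + 2) * (4 * C₀ * C) * dyad u j)) := by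
        refine Finset.sum_le_sum fun x hx => mul_le_mul_of_nonneg_left ?_ (hμ x)
        exact mul_le_mul_of_nonneg_left (h2 x hx) hr.le
    _ = (∑ x ∈ S, μ x) * (r * ((j + 2) * (4 * C₀ * C) * dyad u j)) := by rw [Finset.sum_mul]
    _ ≤ 1 * (r * ((j + 2) * (4 * C₀ * C) * dyad u j)) := by
        refine mul_le_mul_of_nonneg_right hsum ?_
        have := (dyad_pos u j).le
        positivity
    _ = _ := by rw [dyad_exp_add]; ring

end lineSum

section thinTubes

variable {α : Type*}

/-- The tubes from the left points are thin with respect to the right weight, along `H`. -/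
def ThinFromLeft (p q : α → ℝ) (T : Finset α) (ν : α → ℝ) (H : Set (α × α)) (A t : ℝ) (k : ℕ) :
    Prop :=
  ∀ e ∈ H, ∀ i ≤ k,
    mass T ν (fun z => (e.1, z) ∈ H ∧ lineDev p q e.1 e.2 z ≤ dyad 1 i) ≤ A * dyad t i

/-- The tubes spanned by `H` are thin with respect to the left weight. -/
def ThinFromRight (p q : α → ℝ) (S : Finset α) (μ : α → ℝ) (H : Set (α × α)) (B σ : ℝ) (k : ℕ) :
    Prop :=
  ∀ e ∈ H, ∀ i ≤ k, mass S μ (fun z => lineDev p q e.1 e.2 z ≤ dyad 1 i) ≤ B * dyad σ i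

/-- The mass of a set of pairs. -/
def pairMass (S T : Finset α) (μ ν : α → ℝ) (H : Set (α × α)) : ℝ :=
  mass (S ×ˢ T) (fun e => μ e.1 * ν e.2) (· ∈ H)

lemma oscLineSum_eq_mass (p q : α → ℝ) (S : Finset α) (μ : α → ℝ) {K r : ℝ} (hr : 0 < r)
    (a b : ℝ) : oscLineSum p q S μ K r a b =
      mass S μ (fun z => |q z - a * p z - b| ≤ 2 * r) -
        K⁻¹ * mass S μ (fun z => |q z - a * p z - b| ≤ 2 * K * r) := by
  classical
  unfold oscLineSum mass
  rw [Finset.mul_sum, ← Finset.sum_sub_distrib]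
  refine Finset.sum_congr rfl fun z _ => ?_
  have h : ∀ c v : ℝ, (v / r ∈ Icc (-c) c) ↔ |v| ≤ c * r := fun c v => by
    rw [mem_Icc, ← abs_le, abs_div, abs_of_pos hr, div_le_iff₀ hr]
  simp only [oscProfile, indicator_apply, h]
  split_ifs <;> ring

lemma lineSlope_mul {p q : α → ℝ} {x y : α} (h : p x ≠ p y) :
    lineSlope p q x y * (p y - p x) = q y - q x := by
  unfold lineSlope
  field_simp [sub_ne_zero.2 h.symm]

lemma abs_lineDev_sub_le {p q : α → ℝ} {x y z : α} {a b ρ₁ ρ₂ D : ℝ}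
    (ha : |a - lineSlope p q x y| ≤ ρ₁) (hb : |q x - a * p x - b| ≤ ρ₂) (hz : |p z - p x| ≤ D) :
    |(q z - a * p z - b) - (q z - q x - lineSlope p q x y * (p z - p x))| ≤ ρ₁ * D + ρ₂ := by
  have h : (q z - a * p z - b) - (q z - q x - lineSlope p q x y * (p z - p x)) =
      -((a - lineSlope p q x y) * (p z - p x)) + (q x - a * p x - b) := by ring
  rw [h]
  refine (abs_add_le _ _).trans (add_le_add ?_ hb)
  rw [abs_neg, abs_mul]
  exact mul_le_mul ha hz (abs_nonneg _) ((abs_nonneg _).trans ha)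

/-- Pointwise domination of the number of heavy tubes near a line by the squared oscillating
tube sum. -/
lemma mass_near_line_mul_le {p q : α → ℝ} {S T : Finset α} {μ ν : α → ℝ}
    {L D C₀ u s A B t σ : ℝ} {k j κ : ℕ} (hc : FrostmanPair p q S T μ ν L D C₀ u s k)
    (hD : 1 ≤ D) (hA : 0 ≤ A) (hB : 0 < B) (hj : j ≤ k) (hκj : κ + 2 ≤ j)
    (hκ : 2 * (1 / 2) ^ κ ≤ dyad σ (κ + 2)) {H bad : Set (α × α)} (hbH : bad ⊆ H)
    (hbST : bad ⊆ {e | e.1 ∈ S ∧ e.2 ∈ T})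
    (hH : ThinFromLeft p q T ν H A t k)
    (hheavy : ∀ e ∈ bad, B * dyad σ j < mass S μ (fun z => lineDev p q e.1 e.2 z ≤ dyad 1 j))
    (hlight : ∀ e ∈ bad, ∀ i < j,
      mass S μ (fun z => lineDev p q e.1 e.2 z ≤ dyad 1 i) ≤ B * dyad σ i) (a b : ℝ) :
    mass (S ×ˢ T) (fun e => μ e.1 * ν e.2) (fun e => e ∈ bad ∧
      |a - lineSlope p q e.1 e.2| ≤ dyad 1 j / (4 * D) ∧ |q e.1 - a * p e.1 - b| ≤ dyad 1 j / 2) *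
      (B * dyad σ j) ≤
      4 * A * dyad t j *
        (tentCutoff (L + 1) a * oscLineSum p q S μ (2 ^ κ) (dyad 1 j) a b ^ 2) := by
  set r := dyad 1 j with hrdef
  have hr : 0 < r := dyad_pos 1 j
  have hr1 : r ≤ 1 := dyad_le_one zero_le_one j
  set F := oscLineSum p q S μ (2 ^ κ) r a b with hF
  have hσj := dyad_pos σ j
  have htj := dyad_pos t j
  set Near : α × α → Prop := fun e => |a - lineSlope p q e.1 e.2| ≤ r / (4 * D) ∧
    |q e.1 - a * p e.1 - b| ≤ r / 2 with hNear
  set m := mass S μ (fun z => |q z - a * p z - b| ≤ 2 * r) with hm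
  have hηD : r / (4 * D) * D = r / 4 := by field_simp
  by_cases hex : ∃ e ∈ bad, Near e
  swap
  · rw [mass_eq_zero, zero_mul]
    · have := tentCutoff_nonneg (L + 1) a
      positivity
    · rintro e - ⟨he, hN⟩
      exact hex ⟨e, he, hN⟩
  obtain ⟨⟨x₀, y₀⟩, he, hN⟩ := hex
  obtain ⟨hx₀, hy₀⟩ : x₀ ∈ S ∧ y₀ ∈ T := hbST he
  have hdev : ∀ z ∈ S, |(q z - a * p z - b) -
      (q z - q x₀ - lineSlope p q x₀ y₀ * (p z - p x₀))| ≤ 3 / 4 * r := fun z hz => by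
    have := abs_lineDev_sub_le hN.1 hN.2 (hc.diam_left x₀ hx₀ z hz)
    simp only [hηD] at this
    linarith
  -- the tube around the line is heavy at scale `r` and light at the larger scale
  have hm1 : mass S μ (fun z => lineDev p q x₀ y₀ z ≤ r) ≤ m := by
    refine mass_mono hc.μ_nonneg fun z hz h => ?_
    have h1 := hdev z hz
    have h2 := abs_sub_abs_le_abs_sub (q z - a * p z - b)
      (q z - q x₀ - lineSlope p q x₀ y₀ * (p z - p x₀))
    unfold lineDev at h
    linarith
  have hm2 :
      mass S μ (fun z => |q z - a * p z - b| ≤ 2 * 2 ^ κ * r) ≤ B * dyad σ (j - (κ + 2)) := by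
    refine le_trans (mass_mono hc.μ_nonneg fun z hz h => ?_) (hlight _ he (j - (κ + 2)) (by omega))
    have h1 := hdev z hz
    have h2 := abs_sub_abs_le_abs_sub
      (q z - q x₀ - lineSlope p q x₀ y₀ * (p z - p x₀)) (q z - a * p z - b)
    rw [abs_sub_comm (q z - q x₀ - lineSlope p q x₀ y₀ * (p z - p x₀)) (q z - a * p z - b)] at h2
    have h3 : dyad 1 (j - (κ + 2)) = 4 * 2 ^ κ * r := by
      have : r = dyad 1 (j - (κ + 2)) * dyad 1 (κ + 2) := by
        rw [← dyad_add, Nat.sub_add_cancel hκj]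
      rw [this, dyad_one (κ + 2), pow_add, one_div, inv_pow]
      field_simp
      norm_num
    have h4 : (1 : ℝ) ≤ 2 ^ κ := one_le_pow₀ one_le_two
    simp only [lineDev, h3]
    nlinarith
  have hheavy₀ := hheavy _ he
  have hFm : m ≤ 2 * F := by
    have h1 : F = m - (2 ^ κ)⁻¹ * mass S μ (fun z => |q z - a * p z - b| ≤ 2 * 2 ^ κ * r) :=
      oscLineSum_eq_mass p q S μ hr a b
    have h2 : ((2 : ℝ) ^ κ)⁻¹ * mass S μ (fun z => |q z - a * p z - b| ≤ 2 * 2 ^ κ * r) ≤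
        B * dyad σ j / 2 := by
      have h3 : dyad σ j = dyad σ (j - (κ + 2)) * dyad σ (κ + 2) := by
        rw [← dyad_add, Nat.sub_add_cancel hκj]
      have h4 := dyad_pos σ (j - (κ + 2))
      calc _ ≤ ((2 : ℝ) ^ κ)⁻¹ * (B * dyad σ (j - (κ + 2))) := by gcongr
        _ = (1 / 2) ^ κ * (B * dyad σ (j - (κ + 2))) := by rw [one_div, inv_pow]
        _ ≤ dyad σ (κ + 2) / 2 * (B * dyad σ (j - (κ + 2))) := by
          refine mul_le_mul_of_nonneg_right (by linarith) (by positivity)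
        _ = _ := by rw [h3]; ring
    linarith
  -- few right points lie near the line through a given left point
  have hcount : mass (S ×ˢ T) (fun e => μ e.1 * ν e.2) (fun e => e ∈ bad ∧ Near e) ≤
      m * (A * dyad t j) := by
    rw [mass_product, hm, ← mass_mul_const, mass]
    refine Finset.sum_le_sum fun x hx => ?_
    have hAt : 0 ≤ A * dyad t j := by positivity
    by_cases hex : ∃ y, (x, y) ∈ bad ∧ Near (x, y)
    · obtain ⟨y, hy, hNy⟩ := hex
      rw [if_pos (hNy.2.trans (by linarith))]
      refine mul_le_mul_of_nonneg_left (le_trans ?_ (hH _ (hbH hy) j hj)) (hc.μ_nonneg x)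
      refine mass_mono hc.ν_nonneg fun z hz hzN => ⟨hbH hzN.1, ?_⟩
      have h1 : |lineSlope p q x z - lineSlope p q x y| ≤ 2 * (r / (4 * D)) := by
        have := abs_sub_le (lineSlope p q x z) a (lineSlope p q x y)
        have h2 := hzN.2.1
        have h3 := hNy.1
        rw [abs_sub_comm] at h2
        simp only at h2 h3
        linarith
      have h2 := hc.diam_cross x hx z hz
      have h3 : lineDev p q x y z = |lineSlope p q x z - lineSlope p q x y| * |p z - p x| := by
        rw [← abs_mul, sub_mul, lineSlope_mul (hc.ne x hx z hz)]; rfl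
      simp only [h3]
      calc _ ≤ 2 * (r / (4 * D)) * D := mul_le_mul h1 h2 (abs_nonneg _) (by positivity)
        _ ≤ r := by rw [mul_assoc, hηD]; linarith
    · rw [mass_eq_zero fun z _ h => hex ⟨z, h⟩, mul_zero]
      split_ifs
      · exact mul_nonneg (hc.μ_nonneg x) hAt
      · exact le_rfl
  have htent : tentCutoff (L + 1) a = 1 := by
    apply tentCutoff_eq_one
    have h1 := hc.slope_le x₀ hx₀ y₀ hy₀
    have h2 := hN.1
    have h3 := abs_sub_abs_le_abs_sub a (lineSlope p q x₀ y₀)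
    have h4 : r / (4 * D) ≤ 1 := by
      rw [div_le_one (by linarith)]; linarith
    simp only at h2
    linarith
  rw [htent, one_mul]
  have hlow : B * dyad σ j ≤ m := hheavy₀.le.trans hm1
  have hBσ : 0 < B * dyad σ j := by positivity
  calc _ ≤ m * (A * dyad t j) * (B * dyad σ j) := mul_le_mul_of_nonneg_right hcount hBσ.le
    _ ≤ m * (A * dyad t j) * m := by
      refine mul_le_mul_of_nonneg_left hlow ?_
      have : 0 ≤ m := hBσ.le.trans hlow
      positivity
    _ = A * dyad t j * m ^ 2 := by ring
    _ ≤ A * dyad t j * (2 * F) ^ 2 := by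
      refine mul_le_mul_of_nonneg_left ?_ (by positivity)
      exact pow_le_pow_left₀ (hBσ.le.trans hlow) hFm 2
    _ = _ := by ring

lemma integral_indicator_Icc_one (c ρ : ℝ) (hρ : 0 ≤ ρ) :
    ∫ v, (Icc (c - ρ) (c + ρ)).indicator (fun _ => (1 : ℝ)) v = 2 * ρ := by
  rw [integral_indicator measurableSet_Icc]
  simp only [integral_const, MeasurableSet.univ, measureReal_restrict_apply, univ_inter,
    Real.volume_real_Icc, smul_eq_mul, mul_one]
  rw [max_eq_left (by linarith)]
  ring

/-- The line-space integral of the mass of pairs whose line is near the given line. -/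
lemma integral_mass_near_line (p q : α → ℝ) (S T : Finset α) (w : α × α → ℝ) (bad : Set (α × α))
    {ρ₁ ρ₂ : ℝ} (h₁ : 0 ≤ ρ₁) (h₂ : 0 ≤ ρ₂) :
    (∀ a, Integrable fun b => mass (S ×ˢ T) w (fun e => e ∈ bad ∧
      |a - lineSlope p q e.1 e.2| ≤ ρ₁ ∧ |q e.1 - a * p e.1 - b| ≤ ρ₂)) ∧
    (Integrable fun a => ∫ b, mass (S ×ˢ T) w (fun e => e ∈ bad ∧
      |a - lineSlope p q e.1 e.2| ≤ ρ₁ ∧ |q e.1 - a * p e.1 - b| ≤ ρ₂)) ∧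
    ∫ a, ∫ b, mass (S ×ˢ T) w (fun e => e ∈ bad ∧
      |a - lineSlope p q e.1 e.2| ≤ ρ₁ ∧ |q e.1 - a * p e.1 - b| ≤ ρ₂) =
      mass (S ×ˢ T) w (· ∈ bad) * (2 * ρ₁) * (2 * ρ₂) := by
  classical
  set I : ℝ → ℝ → ℝ → ℝ := fun c ρ v => (Icc (c - ρ) (c + ρ)).indicator (fun _ => (1 : ℝ)) v
    with hI
  have hmem : ∀ c ρ v : ℝ, v ∈ Icc (c - ρ) (c + ρ) ↔ |v - c| ≤ ρ := fun c ρ v => by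
    rw [abs_le, mem_Icc]; constructor <;> rintro ⟨_, _⟩ <;> constructor <;> linarith
  have hint : ∀ c ρ : ℝ, Integrable (I c ρ) := fun c ρ => integrable_indicator_Icc_one _ _
  have h : ∀ a b, mass (S ×ˢ T) w (fun e => e ∈ bad ∧
      |a - lineSlope p q e.1 e.2| ≤ ρ₁ ∧ |q e.1 - a * p e.1 - b| ≤ ρ₂) =
      ∑ e ∈ S ×ˢ T, (if e ∈ bad then w e else 0) * I (lineSlope p q e.1 e.2) ρ₁ a *
        I (q e.1 - a * p e.1) ρ₂ b := by
    intro a b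
    unfold mass
    refine Finset.sum_congr rfl fun e _ => ?_
    simp only [hI, indicator_apply, hmem, abs_sub_comm b]
    split_ifs <;> simp_all
  simp_rw [h]
  have hb : ∀ a, ∫ b, ∑ e ∈ S ×ˢ T, (if e ∈ bad then w e else 0) *
      I (lineSlope p q e.1 e.2) ρ₁ a * I (q e.1 - a * p e.1) ρ₂ b =
      ∑ e ∈ S ×ˢ T, (if e ∈ bad then w e else 0) * (2 * ρ₂) * I (lineSlope p q e.1 e.2) ρ₁ a := by
    intro a
    rw [integral_finsetSum _ fun e _ => (hint _ _).const_mul _]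
    refine Finset.sum_congr rfl fun e _ => ?_
    rw [integral_const_mul, integral_indicator_Icc_one _ _ h₂]
    ring
  refine ⟨fun a => integrable_finsetSum _ fun e _ => (hint _ _).const_mul _, ?_, ?_⟩
  · simp_rw [hb]
    exact integrable_finsetSum _ fun e _ => (hint _ _).const_mul _
  · simp_rw [hb]
    rw [integral_finsetSum _ fun e _ => (hint _ _).const_mul _]
    unfold mass
    rw [Finset.sum_mul, Finset.sum_mul]
    refine Finset.sum_congr rfl fun e _ => ?_
    rw [integral_const_mul, integral_indicator_Icc_one _ _ h₁]
    ring

end thinTubes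

section highLow

variable {α : Type*}

lemma pairMass_le_add_sum {S T : Finset α} {μ ν : α → ℝ} (hμ : ∀ z, 0 ≤ μ z)
    (hν : ∀ z, 0 ≤ ν z) {H H' : Set (α × α)} {bad : ℕ → Set (α × α)} {k : ℕ}
    (h : ∀ e ∈ H, e.1 ∈ S → e.2 ∈ T → e ∈ H' ∨ ∃ j ≤ k, e ∈ bad j) :
    pairMass S T μ ν H ≤
      pairMass S T μ ν H' + ∑ j ∈ Finset.range (k + 1), pairMass S T μ ν (bad j) := by
  have hw : ∀ e : α × α, 0 ≤ μ e.1 * ν e.2 := fun e => mul_nonneg (hμ _) (hν _)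
  have h1 : pairMass S T μ ν H ≤ pairMass S T μ ν H' +
      mass (S ×ˢ T) (fun e => μ e.1 * ν e.2) (fun e => e ∈ H ∧ e ∉ H') := by
    unfold pairMass mass
    rw [← Finset.sum_add_distrib]
    refine Finset.sum_le_sum fun e _ => ?_
    have := hw e
    split_ifs <;> simp_all
  refine h1.trans (add_le_add_right (mass_le_sum_of_cover _ hw fun e he hH => ?_) _)
  obtain ⟨hS, hT⟩ := Finset.mem_product.1 he
  rcases h e hH.1 hS hT with h | ⟨j, hj, hb⟩
  · exact absurd h hH.2
  · exact ⟨j, Finset.mem_range.2 (by omega), hb⟩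

/-- High-low estimate for the pairs whose tube is heavy at scale `2 ^ (-j)` and light at all larger
scales. -/
lemma exists_pairMass_heavy_mul_le {L D : ℝ} (hL : 0 ≤ L) (hD : 1 ≤ D) (κ : ℕ) :
    ∃ C : ℝ, 1 ≤ C ∧ ∀ {α : Type*} {p q : α → ℝ} {S T : Finset α} {μ ν : α → ℝ}
      {C₀ u s A B t σ : ℝ} {k j : ℕ}, FrostmanPair p q S T μ ν L D C₀ u s k → 1 ≤ C₀ → u ≤ 2 →
      0 ≤ A → 2 ^ (κ + 2) ≤ B → σ ≤ 1 → σ + 1 ≤ t + u →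
      2 * (1 / 2) ^ κ ≤ dyad σ (κ + 2) → j ≤ k → ∀ {H bad : Set (α × α)}, bad ⊆ H →
      bad ⊆ {e | e.1 ∈ S ∧ e.2 ∈ T} → ThinFromLeft p q T ν H A t k →
      (∀ e ∈ bad, B * dyad σ j < mass S μ (fun z => lineDev p q e.1 e.2 z ≤ dyad 1 j)) →
      (∀ e ∈ bad, ∀ i < j,
        mass S μ (fun z => lineDev p q e.1 e.2 z ≤ dyad 1 i) ≤ B * dyad σ i) →
      pairMass S T μ ν bad * B ≤ C * C₀ * A * (j + 2) := by
  obtain ⟨C, hC, hosc⟩ := exists_integral_oscLineSum_sq_le (K := 2 ^ κ) (L := L + 1)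
    (one_le_pow₀ one_le_two) (by linarith)
  refine ⟨8 * D * C, by nlinarith, ?_⟩
  intro α p q S T μ ν C₀ u s A B t σ k j hc hC₀ hu hA hB hσ hσt hκ hj H bad hbH hbST hH
    hheavy hlight
  have hB0 : 0 < B := lt_of_lt_of_le (by positivity) hB
  by_cases hκj : κ + 2 ≤ j
  swap
  · have : pairMass S T μ ν bad = 0 := by
      refine mass_eq_zero fun e _ he => ?_
      have h1 := (hheavy e he).trans_le ((mass_le_sum hc.μ_nonneg).trans hc.μ_sum)
      have h2 : (1 / 2 : ℝ) ^ (κ + 2) ≤ dyad σ j := by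
        rw [← dyad_one]
        exact (dyad_anti_right zero_le_one (by omega)).trans (dyad_anti_left hσ j)
      have h3 : (2 : ℝ) ^ (κ + 2) * (1 / 2) ^ (κ + 2) ≤ B * dyad σ j :=
        mul_le_mul hB h2 (by positivity) hB0.le
      rw [← mul_pow] at h3
      norm_num at h3
      linarith
    rw [this, zero_mul]
    positivity
  set r := dyad 1 j with hr
  have hr0 : 0 < r := dyad_pos 1 j
  obtain ⟨hi1, hi2, hi3⟩ := integral_mass_near_line p q S T (fun e => μ e.1 * ν e.2) bad
    (ρ₁ := r / (4 * D)) (ρ₂ := r / 2) (by positivity) (by positivity)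
  have hK : (1 : ℝ) ≤ 2 ^ κ := one_le_pow₀ one_le_two
  have key : pairMass S T μ ν bad * (2 * (r / (4 * D))) * (2 * (r / 2)) * (B * dyad σ j) ≤
      4 * A * dyad t j * (C * C₀ * (j + 2) * dyad (u + 1) j) := by
    have hpt := mass_near_line_mul_le hc hD hA hB0 hj hκj hκ hbH hbST hH hheavy hlight
    have hcoef : 0 ≤ 4 * A * dyad t j := by have := dyad_pos t j; positivity
    refine le_trans ?_ (mul_le_mul_of_nonneg_left (hosc p q S μ C₀ u j hc.μ_nonneg hc.μ_sum hC₀ hu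
      fun x hx i hi => hc.μ_ball x hx i (hi.trans hj)) hcoef)
    unfold pairMass
    rw [← hi3, ← integral_mul_const, ← integral_const_mul]
    refine integral_mono (hi2.mul_const _)
      ((integrable_tentCutoff_mul_integral_oscLineSum_sq p q S μ hK hr0 _).const_mul _) fun a => ?_
    simp only
    rw [← integral_mul_const, ← integral_const_mul, ← integral_const_mul]
    refine integral_mono ((hi1 a).mul_const _)
      (((integrable_oscLineSum_sq p q S μ hK hr0 a).const_mul _).const_mul _) fun b => ?_
    exact hpt a b
  have hpow : dyad t j * dyad (u + 1) j ≤ dyad σ j * r ^ 2 := by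
    rw [← dyad_exp_add, hr, ← dyad_two, ← dyad_exp_add]
    exact dyad_anti_left (by linarith) j
  have hσj := dyad_pos σ j
  have hpos : 0 < dyad σ j * r ^ 2 := by positivity
  refine le_of_mul_le_mul_right ?_ hpos
  have h1 : pairMass S T μ ν bad * (2 * (r / (4 * D))) * (2 * (r / 2)) * (B * dyad σ j) * (2 * D) =
      pairMass S T μ ν bad * B * (dyad σ j * r ^ 2) := by
    field_simp
    ring
  rw [← h1]
  calc _ ≤ 4 * A * dyad t j * (C * C₀ * (j + 2) * dyad (u + 1) j) * (2 * D) := by gcongr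
    _ = 8 * D * C * C₀ * A * (j + 2) * (dyad t j * dyad (u + 1) j) := by ring
    _ ≤ _ := by gcongr

lemma exists_two_mul_pow_le_dyad {s : ℝ} (hs : s < 1) :
    ∃ κ : ℕ, ∀ σ ≤ s, 2 * (1 / 2) ^ κ ≤ dyad σ (κ + 2) := by
  obtain ⟨κ, hκ⟩ := exists_nat_ge (3 / (1 - s))
  rw [div_le_iff₀ (by linarith)] at hκ
  refine ⟨κ, fun σ hσ => le_trans ?_ (dyad_anti_left hσ _)⟩
  have h1 : (2 : ℝ) * (1 / 2) ^ κ = 2 ^ (1 - κ : ℝ) := by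
    rw [Real.rpow_sub two_pos, Real.rpow_one, Real.rpow_natCast, one_div, inv_pow, div_eq_mul_inv]
  have h2 : dyad s (κ + 2) = 2 ^ (-s * (κ + 2) : ℝ) := by
    unfold dyad
    rw [← Real.rpow_natCast, ← Real.rpow_mul zero_le_two]
    push_cast
    rfl
  rw [h1, h2]
  exact Real.rpow_le_rpow_of_exponent_le one_le_two (by nlinarith)

/-- Thin tubes from the left improve to thin tubes from the right after removing few pairs. -/
lemma exists_thinFromRight {L D s' : ℝ} (hL : 0 ≤ L) (hD : 1 ≤ D) (hs' : s' < 1) :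
    ∃ C : ℝ, 1 ≤ C ∧ ∀ {α : Type*} {p q : α → ℝ} {S T : Finset α} {μ ν : α → ℝ}
      {C₀ u s A t σ ε : ℝ} {k : ℕ}, FrostmanPair p q S T μ ν L D C₀ u s k → 1 ≤ C₀ → u ≤ 2 →
      1 ≤ A → σ ≤ s' → σ + 1 ≤ t + u → 0 < ε → ε ≤ 1 →
      ∀ {H : Set (α × α)}, ThinFromLeft p q T ν H A t k →
      ∃ H' ⊆ H, ThinFromRight p q S μ H' (C * C₀ * A * (k + 2) ^ 2 / ε) σ k ∧
        pairMass S T μ ν H ≤ pairMass S T μ ν H' + ε := by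
  obtain ⟨κ, hκ⟩ := exists_two_mul_pow_le_dyad hs'
  obtain ⟨C, hC, hheavy⟩ := exists_pairMass_heavy_mul_le hL hD κ
  refine ⟨2 ^ (κ + 2) * C, one_le_mul_of_one_le_of_one_le (one_le_pow₀ one_le_two) hC, ?_⟩
  intro α p q S T μ ν C₀ u s A t σ ε k hc hC₀ hu hA hσ hσt hε hε1 H hH
  set B := 2 ^ (κ + 2) * C * C₀ * A * (k + 2) ^ 2 / ε with hB
  have hk2 : (1 : ℝ) ≤ (k : ℝ) + 2 := by have := k.cast_nonneg (α := ℝ); linarith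
  have hCA : 1 ≤ C * C₀ * A := by
    have : 1 ≤ C * C₀ := one_le_mul_of_one_le_of_one_le hC hC₀
    exact one_le_mul_of_one_le_of_one_le this hA
  have hB1 : (2 : ℝ) ^ (κ + 2) ≤ B := by
    rw [hB, le_div_iff₀ hε]
    have h1 : (1 : ℝ) ≤ C * C₀ * A * (k + 2) ^ 2 :=
      one_le_mul_of_one_le_of_one_le hCA (one_le_pow₀ hk2)
    have h2 : (0 : ℝ) < 2 ^ (κ + 2) := by positivity
    calc (2 : ℝ) ^ (κ + 2) * ε ≤ 2 ^ (κ + 2) * (C * C₀ * A * (k + 2) ^ 2) := by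
          gcongr; linarith
      _ = _ := by ring
  have hB0 : 0 < B := lt_of_lt_of_le (by positivity) hB1
  set heavy : α × α → ℕ → Prop := fun e j =>
    B * dyad σ j < mass S μ (fun z => lineDev p q e.1 e.2 z ≤ dyad 1 j) with hhv
  set bad : ℕ → Set (α × α) := fun j =>
    {e | e ∈ H ∧ e.1 ∈ S ∧ e.2 ∈ T ∧ heavy e j ∧ ∀ i < j, ¬ heavy e i} with hbad
  refine ⟨{e | e ∈ H ∧ ∀ i ≤ k, ¬ heavy e i}, fun e he => he.1,
    fun e he i hi => not_lt.1 (he.2 i hi), ?_⟩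
  refine (pairMass_le_add_sum hc.μ_nonneg hc.ν_nonneg (bad := bad) (k := k)
    fun e he hS hT => ?_).trans (add_le_add_right ?_ _)
  · classical
    by_cases h : ∃ i ≤ k, heavy e i
    · obtain ⟨i, hi, hv⟩ := h
      have hex : ∃ i, heavy e i := ⟨i, hv⟩
      exact Or.inr ⟨Nat.find hex, (Nat.find_min' hex hv).trans hi, he, hS, hT, Nat.find_spec hex,
        fun i hi => Nat.find_min hex hi⟩
    · push Not at h
      exact Or.inl ⟨he, h⟩
  · have hle : ∀ j ∈ Finset.range (k + 1), pairMass S T μ ν (bad j) ≤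
        C * C₀ * A * (k + 2) / B := fun j hj => by
      have hjk : j ≤ k := by simpa [Nat.lt_succ_iff] using hj
      rw [le_div_iff₀ hB0]
      refine (hheavy hc hC₀ hu (by linarith) hB1 (hσ.trans hs'.le) hσt (hκ σ hσ) hjk
        (fun e he => he.1) (fun e he => ⟨he.2.1, he.2.2.1⟩) hH (fun e he => he.2.2.2.1)
        fun e he i hi => not_lt.1 (he.2.2.2.2 i hi)).trans ?_
      have : (j : ℝ) ≤ k := by exact_mod_cast hjk
      have : 0 ≤ C * C₀ * A := by linarith
      gcongr
    refine (Finset.sum_le_sum hle).trans ?_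
    rw [Finset.sum_const, Finset.card_range, nsmul_eq_mul, ← mul_div_assoc, div_le_iff₀ hB0]
    have h2 : (1 : ℝ) ≤ 2 ^ (κ + 2) := one_le_pow₀ one_le_two
    have h3 : ε * B = 2 ^ (κ + 2) * (C * C₀ * A * (k + 2) ^ 2) := by
      rw [hB]; field_simp
    rw [h3]
    push_cast
    have h4 : 0 ≤ C * C₀ * A * (k + 2) := by positivity
    have h5 : 0 ≤ C * C₀ * A * (k + 2) ^ 2 := by positivity
    nlinarith

end highLow

section duality

variable {α : Type*}

lemma lineDev_eq_of_ne {p q : α → ℝ} {x y z : α} (h : p x ≠ p y) :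
    lineDev p q x y z = |q z - q y - lineSlope p q x y * (p z - p y)| := by
  have := lineSlope_mul (q := q) h
  unfold lineDev
  congr 1
  linear_combination -this

/-- If two lines through `y` pass near a point `z` far from `y`, they are close to each other. -/
lemma lineDev_le_of_common_point {p q : α → ℝ} {x₀ x y z : α} {L D d r : ℝ} (hL : 0 ≤ L)
    (h₀ : p x₀ ≠ p y) (h : p x ≠ p y) (hLx : |lineSlope p q x y| ≤ L)
    (hD : |p y - p x| ≤ D) (hd : 0 < d) (hr : 2 * r ≤ d) (hz : d ≤ coordDist p q y z)
    (hz₀ : lineDev p q x₀ y z ≤ r) (hzx : lineDev p q x y z ≤ r) :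
    lineDev p q x₀ y x * d ≤ 4 * (L + 1) * D * r := by
  set a₀ := lineSlope p q x₀ y
  set a := lineSlope p q x y with ha
  rw [lineDev_eq_of_ne h₀] at hz₀ ⊢
  rw [lineDev_eq_of_ne h] at hzx
  have hr0 : 0 ≤ r := (abs_nonneg _).trans hzx
  have h1 : |a - a₀| * |p z - p y| ≤ 2 * r := by
    rw [← abs_mul]
    have := abs_sub_le ((q z - q y) - a₀ * (p z - p y)) 0 ((q z - q y) - a * (p z - p y))
    rw [sub_zero, zero_sub, abs_neg] at this
    calc _ = |(q z - q y - a₀ * (p z - p y)) - (q z - q y - a * (p z - p y))| := by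
          congr 1; ring
      _ ≤ _ := by linarith
  have h2 : d ≤ 2 * (L + 1) * |p z - p y| := by
    have h3 : |q z - q y| ≤ r + L * |p z - p y| := by
      have h4 := abs_sub_abs_le_abs_sub (q z - q y) (a * (p z - p y))
      rw [abs_mul] at h4
      have h5 := mul_le_mul_of_nonneg_right hLx (abs_nonneg (p z - p y))
      linarith
    have h6 := abs_nonneg (p z - p y)
    rcases le_max_iff.1 hz with h | h <;> nlinarith
  have h3 : |q x - q y - a₀ * (p x - p y)| = |a - a₀| * |p y - p x| := by
    rw [← abs_mul, ← abs_neg]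
    have := lineSlope_mul (q := q) h
    rw [← ha] at this
    congr 1
    linear_combination -this
  rw [h3]
  have hD0 : 0 ≤ D := (abs_nonneg _).trans hD
  calc _ ≤ |a - a₀| * D * (2 * (L + 1) * |p z - p y|) := by gcongr
    _ = 2 * (L + 1) * D * (|a - a₀| * |p z - p y|) := by ring
    _ ≤ 2 * (L + 1) * D * (2 * r) := by gcongr
    _ = _ := by ring

/-- Mass of left points whose line through `y` passes near `z`. -/
lemma mass_line_through_mul_le {p q : α → ℝ} {S T : Finset α} {μ ν : α → ℝ}
    {L D C₀ u s B τ : ℝ} {k i j l : ℕ} (hc : FrostmanPair p q S T μ ν L D C₀ u s k) (hL : 0 ≤ L)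
    (hl1 : 1 ≤ l) (hl : 4 * (L + 1) * D ≤ 2 ^ l) (hτ0 : 0 ≤ τ) (hτ1 : τ ≤ 1) (hB : 1 ≤ B)
    (hj : j ≤ k) {H : Set (α × α)} (hH : ThinFromRight p q S μ H B τ k) {y z : α} (hy : y ∈ T)
    (hz : dyad 1 i ≤ coordDist p q y z) :
    mass S μ (fun x => (x, y) ∈ H ∧ lineDev p q x y z ≤ dyad 1 j) * dyad τ i ≤
      B * 2 ^ l * dyad τ j := by
  have hl0 : (0 : ℝ) < 2 ^ l := by positivity
  have hτl : 1 ≤ 2 ^ l * dyad τ l := by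
    have h := mul_le_mul_of_nonneg_left (dyad_anti_left hτ1 l) hl0.le
    rw [dyad_one, ← mul_pow] at h
    norm_num at h
    exact h
  have hi0 := dyad_pos τ i
  have hj0 := dyad_pos τ j
  by_cases hij : j ≤ i + l
  · have h1 : mass S μ (fun x => (x, y) ∈ H ∧ lineDev p q x y z ≤ dyad 1 j) ≤ 1 :=
      (mass_le_sum hc.μ_nonneg).trans hc.μ_sum
    have h2 := dyad_anti_right hτ0 hij
    rw [dyad_add] at h2
    calc _ ≤ 1 * dyad τ i * (2 ^ l * dyad τ l) := by
          refine le_trans (mul_le_mul_of_nonneg_right h1 hi0.le) ?_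
          exact le_mul_of_one_le_right (by positivity) hτl
      _ = 2 ^ l * (dyad τ i * dyad τ l) := by ring
      _ ≤ 2 ^ l * dyad τ j := mul_le_mul_of_nonneg_left h2 hl0.le
      _ ≤ B * (2 ^ l * dyad τ j) := le_mul_of_one_le_left (by positivity) hB
      _ = _ := by ring
  push Not at hij
  obtain ⟨n, rfl⟩ : ∃ n, j = n + i + l := ⟨j - i - l, by omega⟩
  have hmain : mass S μ (fun x => (x, y) ∈ H ∧ lineDev p q x y z ≤ dyad 1 (n + i + l)) ≤
      B * dyad τ n := by
    have hn0 := dyad_pos τ n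
    by_cases hex : ∃ x₀ ∈ S, (x₀, y) ∈ H ∧ lineDev p q x₀ y z ≤ dyad 1 (n + i + l)
    swap
    · rw [mass_eq_zero fun x hx h => hex ⟨x, hx, h⟩]
      positivity
    obtain ⟨x₀, hx₀, hxH, hx₀z⟩ := hex
    refine (mass_mono hc.μ_nonneg fun x hx hxz => ?_).trans (hH _ hxH n (by omega))
    have hd := dyad_pos 1 i
    have hn := dyad_pos 1 n
    have h2l : dyad 1 l * 2 ^ l = 1 := by
      rw [dyad_one, ← mul_pow]; norm_num
    have hln := dyad_pos 1 l
    have hr : 2 * dyad 1 (n + i + l) ≤ dyad 1 i := by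
      have h1 : dyad 1 l ≤ 1 / 2 := by
        have := dyad_anti_right zero_le_one hl1
        rw [dyad_one 1] at this
        simpa using this
      rw [dyad_add, dyad_add]
      have h2 := dyad_le_one zero_le_one n
      have h3 : dyad 1 n * dyad 1 l ≤ 1 * (1 / 2) := mul_le_mul h2 h1 hln.le zero_le_one
      nlinarith
    have h1 := lineDev_le_of_common_point hL (hc.ne x₀ hx₀ y hy) (hc.ne x hx y hy)
      (hc.slope_le x hx y hy) (hc.diam_cross x hx y hy) hd hr hz hx₀z hxz.2
    refine le_of_mul_le_mul_right (h1.trans ?_) hd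
    rw [dyad_add, dyad_add]
    calc _ ≤ 2 ^ l * (dyad 1 n * dyad 1 i * dyad 1 l) := by gcongr
      _ = dyad 1 n * dyad 1 i * (dyad 1 l * 2 ^ l) := by ring
      _ = _ := by rw [h2l, mul_one]
  have hn0 := dyad_pos τ n
  calc _ ≤ B * dyad τ n * dyad τ i * (2 ^ l * dyad τ l) := by
        refine le_trans (mul_le_mul_of_nonneg_right hmain hi0.le) ?_
        exact le_mul_of_one_le_right (by positivity) hτl
    _ = _ := by rw [dyad_add, dyad_add]; ring

lemma pairMass_mul_le_of_heavy {p q : α → ℝ} {S T : Finset α} {μ ν : α → ℝ}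
    {L D C₀ u s B B' τ : ℝ} {k j l : ℕ} (hc : FrostmanPair p q S T μ ν L D C₀ u s k) (hL : 0 ≤ L)
    (hl1 : 1 ≤ l) (hl : 4 * (L + 1) * D ≤ 2 ^ l) (hC₀ : 1 ≤ C₀) (hτ0 : 0 ≤ τ) (hτ1 : τ ≤ 1)
    (hτs : τ ≤ s) (hB : 1 ≤ B) (hj : j ≤ k) {H bad : Set (α × α)}
    (hH : ThinFromRight p q S μ H B τ k) (hbH : bad ⊆ H)
    (hheavy : ∀ e ∈ bad, B' * dyad τ j <
      mass T ν (fun z => (e.1, z) ∈ H ∧ lineDev p q e.1 e.2 z ≤ dyad 1 j)) :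
    pairMass S T μ ν bad * B' ≤ (j + 2) * (4 * C₀ * (B * 2 ^ l)) := by
  classical
  have hj0 := dyad_pos τ j
  refine le_of_mul_le_mul_right ?_ hj0
  have hF1 : 1 ≤ B * 2 ^ l := one_le_mul_of_one_le_of_one_le hB (one_le_pow₀ one_le_two)
  set f : α → α → ℝ := fun y z =>
    mass S μ (fun x => (x, y) ∈ H ∧ lineDev p q x y z ≤ dyad 1 j) with hf
  have hshell : ∀ y ∈ T, ∑ z ∈ T, ν z * f y z ≤
      (j + 2) * (4 * C₀ * (B * 2 ^ l)) * dyad τ j := fun y hy =>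
    sum_mul_le_of_shells hc.ν_nonneg (by linarith) (by linarith)
      (fun i hi => (hc.ν_ball y hy i (hi.trans hj)).trans
        (mul_le_mul_of_nonneg_left (dyad_anti_left hτs i) (by linarith)))
      (hc.ν_sum.trans hC₀)
      (fun z _ => ((mass_le_sum hc.μ_nonneg).trans hc.μ_sum).trans hF1)
      fun z _ i _ hz => mass_line_through_mul_le hc hL hl1 hl hτ0 hτ1 hB hj hH hy hz
  have h1 : pairMass S T μ ν bad * (B' * dyad τ j) ≤ ∑ y ∈ T, ν y * ∑ z ∈ T, ν z * f y z := by
    have hterm : ∀ e ∈ S ×ˢ T, (if e ∈ bad then μ e.1 * ν e.2 * (B' * dyad τ j) else 0) ≤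
        ∑ z ∈ T, ν e.2 * (ν z * if e ∈ H ∧ lineDev p q e.1 e.2 z ≤ dyad 1 j then μ e.1 else 0) := by
      intro e _
      have hμ := hc.μ_nonneg e.1
      have hν := hc.ν_nonneg e.2
      split_ifs with he
      · refine (mul_le_mul_of_nonneg_left (hheavy e he).le (mul_nonneg hμ hν)).trans ?_
        unfold mass
        rw [Finset.mul_sum]
        refine Finset.sum_le_sum fun z _ => ?_
        have hνz := hc.ν_nonneg z
        by_cases h : lineDev p q e.1 e.2 z ≤ dyad 1 j
        · rw [if_pos (⟨hbH he, h⟩ : e ∈ H ∧ _)]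
          split_ifs
          · exact le_of_eq (by ring)
          · rw [mul_zero]; exact mul_nonneg hν (mul_nonneg hνz hμ)
        · simp [h]
      · refine Finset.sum_nonneg fun z _ => ?_
        have hνz := hc.ν_nonneg z
        split_ifs <;> positivity
    rw [pairMass, ← mass_mul_const]
    refine (Finset.sum_le_sum hterm).trans (le_of_eq ?_)
    rw [Finset.sum_product_right]
    refine Finset.sum_congr rfl fun y _ => ?_
    rw [Finset.sum_comm, Finset.mul_sum]
    refine Finset.sum_congr rfl fun z _ => ?_
    rw [hf]
    simp only [mass, Finset.mul_sum]
    congr!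
  have hnn : 0 ≤ ((j : ℝ) + 2) * (4 * C₀ * (B * 2 ^ l)) * dyad τ j := by positivity
  calc _ = pairMass S T μ ν bad * (B' * dyad τ j) := by ring
    _ ≤ _ := h1
    _ ≤ ∑ y ∈ T, ν y * ((j + 2) * (4 * C₀ * (B * 2 ^ l)) * dyad τ j) :=
      Finset.sum_le_sum fun y hy => mul_le_mul_of_nonneg_left (hshell y hy) (hc.ν_nonneg y)
    _ = (∑ y ∈ T, ν y) * ((j + 2) * (4 * C₀ * (B * 2 ^ l)) * dyad τ j) := by
      rw [Finset.sum_mul]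
    _ ≤ 1 * _ := mul_le_mul_of_nonneg_right hc.ν_sum hnn
    _ = _ := one_mul _

/-- Thin tubes from the right give thin tubes from the left after removing few pairs. -/
lemma exists_thinFromLeft {L D : ℝ} (hL : 0 ≤ L) :
    ∃ C : ℝ, 1 ≤ C ∧ ∀ {α : Type*} {p q : α → ℝ} {S T : Finset α} {μ ν : α → ℝ}
      {C₀ u s B τ ε : ℝ} {k : ℕ}, FrostmanPair p q S T μ ν L D C₀ u s k → 1 ≤ C₀ →
      1 ≤ B → 0 ≤ τ → τ ≤ 1 → τ ≤ s → 0 < ε → ∀ {H : Set (α × α)},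
      ThinFromRight p q S μ H B τ k →
      ∃ H' ⊆ H, ThinFromLeft p q T ν H' (C * C₀ * B * (k + 2) ^ 2 / ε) τ k ∧
        pairMass S T μ ν H ≤ pairMass S T μ ν H' + ε := by
  obtain ⟨l, hl⟩ := pow_unbounded_of_one_lt (4 * (L + 1) * D) (one_lt_two (α := ℝ))
  have hl' : 4 * (L + 1) * D ≤ 2 ^ (l + 1) :=
    hl.le.trans (pow_le_pow_right₀ one_le_two (Nat.le_succ l))
  refine ⟨4 * 2 ^ (l + 1), ?_, ?_⟩
  · have : (1 : ℝ) ≤ 2 ^ (l + 1) := one_le_pow₀ one_le_two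
    linarith
  intro α p q S T μ ν C₀ u s B τ ε k hc hC₀ hB hτ0 hτ1 hτs hε H hH
  set B' := 4 * 2 ^ (l + 1) * C₀ * B * (k + 2) ^ 2 / ε with hB'
  have hB'0 : 0 < B' := by positivity
  set heavy : α × α → ℕ → Prop := fun e j => B' * dyad τ j <
    mass T ν (fun z => (e.1, z) ∈ H ∧ lineDev p q e.1 e.2 z ≤ dyad 1 j) with hhv
  refine ⟨{e | e ∈ H ∧ ∀ i ≤ k, ¬ heavy e i}, fun e he => he.1, fun e he i hi => ?_, ?_⟩
  · exact (mass_mono hc.ν_nonneg fun z _ hz => ⟨hz.1.1, hz.2⟩).trans (not_lt.1 (he.2 i hi))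
  refine (pairMass_le_add_sum hc.μ_nonneg hc.ν_nonneg (k := k)
    (bad := fun j => {e | e ∈ H ∧ heavy e j}) fun e he _ _ => ?_).trans (add_le_add_right ?_ _)
  · by_cases h : ∃ i ≤ k, heavy e i
    · obtain ⟨i, hi, hv⟩ := h
      exact Or.inr ⟨i, hi, he, hv⟩
    · push Not at h
      exact Or.inl ⟨he, h⟩
  · have hle : ∀ j ∈ Finset.range (k + 1), pairMass S T μ ν {e | e ∈ H ∧ heavy e j} ≤
        (k + 2) * (4 * C₀ * (B * 2 ^ (l + 1))) / B' := fun j hj => by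
      have hjk : j ≤ k := by simpa [Nat.lt_succ_iff] using hj
      rw [le_div_iff₀ hB'0]
      refine (pairMass_mul_le_of_heavy hc hL (Nat.le_add_left 1 l) hl' hC₀ hτ0 hτ1 hτs hB hjk hH
        (fun e he => he.1) fun e he => he.2).trans ?_
      have : (j : ℝ) ≤ k := by exact_mod_cast hjk
      gcongr
    refine (Finset.sum_le_sum hle).trans ?_
    rw [Finset.sum_const, Finset.card_range, nsmul_eq_mul, ← mul_div_assoc, div_le_iff₀ hB'0]
    have h3 : ε * B' = 4 * 2 ^ (l + 1) * C₀ * B * (k + 2) ^ 2 := by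
      rw [hB']; field_simp
    rw [h3]
    push_cast
    have h4 : 0 ≤ (k + 2) * (4 * C₀ * (B * 2 ^ (l + 1))) := by positivity
    nlinarith

end duality

section bootstrap

/-- One step of the bootstrap: the exponent of the tubes from the left increases. -/
lemma exists_thinFromLeft_step {L D s : ℝ} (hL : 0 ≤ L) (hD : 1 ≤ D) (hs : s < 1) :
    ∃ C : ℝ, 1 ≤ C ∧ ∀ {α : Type*} {p q : α → ℝ} {S T : Finset α} {μ ν : α → ℝ}
      {C₀ u A t σ ε : ℝ} {k : ℕ}, FrostmanPair p q S T μ ν L D C₀ u s k → 1 ≤ C₀ → u ≤ 2 →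
      1 ≤ A → 0 ≤ σ → σ ≤ s → σ + 1 ≤ t + u → 0 < ε → ε ≤ 1 →
      ∀ {H : Set (α × α)}, ThinFromLeft p q T ν H A t k →
      ∃ H' ⊆ H, ThinFromLeft p q T ν H' (C * C₀ ^ 2 * (k + 2) ^ 4 / ε ^ 2 * A) σ k ∧
        pairMass S T μ ν H ≤ pairMass S T μ ν H' + 2 * ε := by
  obtain ⟨C₁, hC₁, h₁⟩ := exists_thinFromRight hL hD hs
  obtain ⟨C₂, hC₂, h₂⟩ := exists_thinFromLeft (D := D) hL
  refine ⟨C₂ * C₁, one_le_mul_of_one_le_of_one_le hC₂ hC₁, ?_⟩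
  intro α p q S T μ ν C₀ u A t σ ε k hc hC₀ hu hA hσ0 hσs hσt hε hε1 H hH
  obtain ⟨H₁, hH₁, hthin₁, hm₁⟩ := h₁ hc hC₀ hu hA hσs hσt hε hε1 hH
  have hB : 1 ≤ C₁ * C₀ * A * (k + 2) ^ 2 / ε := by
    rw [le_div_iff₀ hε, one_mul]
    refine hε1.trans (one_le_mul_of_one_le_of_one_le (one_le_mul_of_one_le_of_one_le
      (one_le_mul_of_one_le_of_one_le hC₁ hC₀) hA) (one_le_pow₀ ?_))
    have := k.cast_nonneg (α := ℝ)
    linarith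
  obtain ⟨H₂, hH₂, hthin₂, hm₂⟩ := h₂ hc hC₀ hB hσ0 (hσs.trans hs.le) hσs hε hthin₁
  refine ⟨H₂, hH₂.trans hH₁, ?_, by linarith⟩
  convert hthin₂ using 1
  field_simp

lemma exists_thinFromLeft_iterate {L D s u : ℝ} (hL : 0 ≤ L) (hD : 1 ≤ D) (hs0 : 0 ≤ s)
    (hs : s < 1) (hu1 : 1 ≤ u) (hu : u ≤ 2) :
    ∃ C : ℝ, 1 ≤ C ∧ ∀ {α : Type*} {p q : α → ℝ} {S T : Finset α} {μ ν : α → ℝ}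
      {C₀ ε : ℝ} {k : ℕ}, FrostmanPair p q S T μ ν L D C₀ u s k → 1 ≤ C₀ → 0 < ε → ε ≤ 1 →
      ∀ n : ℕ, ∃ H : Set (α × α),
        ThinFromLeft p q T ν H ((C * C₀ ^ 2 * (k + 2) ^ 4 / ε ^ 2) ^ n) (min (n * (u - 1)) s) k ∧
        pairMass S T μ ν univ ≤ pairMass S T μ ν H + n * (2 * ε) := by
  obtain ⟨C, hC, hstep⟩ := exists_thinFromLeft_step hL hD hs
  refine ⟨C, hC, fun {α p q S T μ ν C₀ ε k} hc hC₀ hε hε1 n => ?_⟩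
  have hG : 1 ≤ C * C₀ ^ 2 * (k + 2) ^ 4 / ε ^ 2 := by
    rw [le_div_iff₀ (by positivity), one_mul]
    refine (pow_le_one₀ hε.le hε1).trans (one_le_mul_of_one_le_of_one_le
      (one_le_mul_of_one_le_of_one_le hC (one_le_pow₀ hC₀)) (one_le_pow₀ ?_))
    have := k.cast_nonneg (α := ℝ)
    linarith
  induction n with
  | zero =>
    refine ⟨univ, fun e _ i _ => ?_, by simp⟩
    simpa [min_eq_left hs0] using (mass_le_sum hc.ν_nonneg).trans hc.ν_sum
  | succ n ih =>
    obtain ⟨H, hH, hm⟩ := ih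
    obtain ⟨H', -, hH', hm'⟩ := hstep hc hC₀ hu (one_le_pow₀ (n := n) hG)
      (σ := min ((n + 1 : ℕ) * (u - 1)) s)
      (le_min (mul_nonneg (Nat.cast_nonneg _) (by linarith)) hs0)
      (min_le_right _ _) (by
        push_cast
        rcases le_total (n * (u - 1)) s with h | h
        · rw [min_eq_left h]
          linarith [min_le_left (((n : ℝ) + 1) * (u - 1)) s]
        · rw [min_eq_right h]
          linarith [min_le_right (((n : ℝ) + 1) * (u - 1)) s]) hε hε1 hH
    refine ⟨H', by rwa [pow_succ'], ?_⟩
    push_cast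
    linarith

lemma exists_forall_mul_pow_mul_dyad_lt_one {η : ℝ} (hη : 0 < η) (M : ℝ) (m : ℕ) :
    ∃ k₀ : ℕ, ∀ k ≥ k₀, M * ((k : ℝ) + 2) ^ m * dyad η k < 1 := by
  have hr : |(2 : ℝ) ^ (-η)| < 1 := by
    rw [abs_of_pos (by positivity)]
    exact Real.rpow_lt_one_of_one_lt_of_neg one_lt_two (by linarith)
  have h := ((tendsto_pow_const_mul_const_pow_of_abs_lt_one m hr).comp
    (Filter.tendsto_add_atTop_nat 2)).const_mul (M * (dyad η 2)⁻¹)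
  rw [mul_zero] at h
  obtain ⟨k₀, hk₀⟩ := Filter.eventually_atTop.1 (h.eventually_lt_const one_pos)
  refine ⟨k₀, fun k hk => ?_⟩
  have h2 := (dyad_pos η 2).ne'
  have := hk₀ k hk
  have h3 : ((2 : ℝ) ^ (-η)) ^ (k + 2) = dyad η k * dyad η 2 := dyad_add η k 2
  simp only [Function.comp_apply, h3] at this
  push_cast at this
  refine lt_of_eq_of_lt ?_ this
  field_simp

/-- A pair of Frostman weights cannot have few directions at a very small scale from each of the
left points. -/
theorem exists_frostmanPair_few_directions_false {L D C₀ c u s τ : ℝ} (hL : 0 ≤ L) (hD : 1 ≤ D)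
    (hC₀ : 1 ≤ C₀) (hc0 : 0 < c) (hc1 : c ≤ 1) (hu1 : 1 < u) (hu : u ≤ 2) (hτ : 0 ≤ τ)
    (hτs : τ < s) (hs : s < 1) (l : ℕ) :
    ∃ k₀ : ℕ, ∀ k ≥ k₀, ∀ {α : Type*} {p q : α → ℝ} {S T : Finset α} {μ ν : α → ℝ},
      FrostmanPair p q S T μ ν L D C₀ u s k → c / ((k : ℝ) + 2) ^ 2 ≤ ∑ x ∈ S, μ x →
      ∀ (J : α → Finset (Set α)), (∀ x ∈ S, ((J x).card : ℝ) * dyad τ k ≤ 1) →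
      (∀ x ∈ S, ∀ P ∈ J x, ∀ y ∈ T, ∀ z ∈ T, y ∈ P → z ∈ P →
        lineDev p q x y z ≤ 2 ^ l * dyad 1 k) →
      (∀ x ∈ S, c / ((k : ℝ) + 2) ^ 2 ≤ mass T ν (fun y => ∃ P ∈ J x, y ∈ P)) → False := by
  obtain ⟨C, hC, hiter⟩ := exists_thinFromLeft_iterate (u := u) hL hD (hτ.trans hτs.le) hs hu1.le hu
  obtain ⟨N, hN⟩ := exists_nat_ge (s / (u - 1) + 1)
  have hN1 : (1 : ℝ) ≤ N := by
    have : 0 ≤ s / (u - 1) := div_nonneg (by linarith) (by linarith)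
    linarith
  have hNs : s ≤ N * (u - 1) := by
    rw [← div_le_iff₀ (by linarith)]; linarith
  set G : ℝ := C * C₀ ^ 2 / (c ^ 2 / (4 * N)) ^ 2 with hG
  obtain ⟨k₁, hk₁⟩ := exists_forall_mul_pow_mul_dyad_lt_one (sub_pos.2 hτs)
    (2 / c ^ 2 * G ^ N * 2 ^ l) (4 + 12 * N)
  refine ⟨max k₁ l, fun k hk α p q S T μ ν hc hμc J hJ hdev hνc => ?_⟩
  have hkl : l ≤ k := (le_max_right _ _).trans hk
  set X : ℝ := (k : ℝ) + 2 with hX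
  have hX1 : 1 ≤ X := by have := k.cast_nonneg (α := ℝ); linarith
  have hX0 : 0 < X := by linarith
  set ε : ℝ := c ^ 2 / (4 * N) / X ^ 4 with hε
  have hε0 : 0 < ε := by positivity
  have hε1 : ε ≤ 1 := by
    refine div_le_one_of_le₀ (le_trans ?_ (one_le_pow₀ hX1)) (by positivity)
    refine div_le_one_of_le₀ ?_ (by positivity)
    nlinarith
  obtain ⟨H, hH, hm⟩ := hiter hc hC₀ hε0 hε1 N
  rw [min_eq_right hNs] at hH
  have hGε : C * C₀ ^ 2 * X ^ 4 / ε ^ 2 = G * X ^ 12 := by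
    rw [hG, hε]; field_simp
  rw [hGε] at hH
  have hG0 : 0 ≤ G := by positivity
  set Good : Set (α × α) := {e | ∃ P ∈ J e.1, e.2 ∈ P} with hGood
  have hlow : c ^ 2 / X ^ 4 ≤ pairMass S T μ ν Good := by
    rw [pairMass, mass_product]
    calc c ^ 2 / X ^ 4 = c / X ^ 2 * (c / X ^ 2) := by field_simp
      _ ≤ (∑ x ∈ S, μ x) * (c / X ^ 2) := by gcongr
      _ ≤ _ := by
        rw [Finset.sum_mul]
        exact Finset.sum_le_sum fun x hx => mul_le_mul_of_nonneg_left (hνc x hx) (hc.μ_nonneg x)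
  have hsplit : pairMass S T μ ν Good + pairMass S T μ ν H ≤
      pairMass S T μ ν univ + pairMass S T μ ν (H ∩ Good) := by
    unfold pairMass mass
    rw [← Finset.sum_add_distrib, ← Finset.sum_add_distrib]
    refine Finset.sum_le_sum fun e _ => ?_
    have := mul_nonneg (hc.μ_nonneg e.1) (hc.ν_nonneg e.2)
    by_cases h1 : e ∈ H <;> by_cases h2 : e ∈ Good <;> simp [h1, h2, this]
  have hNε : N * (2 * ε) = c ^ 2 / X ^ 4 / 2 := by rw [hε]; field_simp; norm_num
  have hup : pairMass S T μ ν (H ∩ Good) * dyad τ k ≤ (G * X ^ 12) ^ N * dyad s (k - l) := by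
    have hR0 : 0 ≤ (G * X ^ 12) ^ N * dyad s (k - l) := by
      have := dyad_pos s (k - l); positivity
    rw [pairMass, mass_product, Finset.sum_mul]
    have hx : ∀ x ∈ S, μ x * mass T ν (fun y => (x, y) ∈ H ∩ Good) * dyad τ k ≤
        μ x * ((G * X ^ 12) ^ N * dyad s (k - l)) := by
      intro x hx
      rw [mul_assoc]
      refine mul_le_mul_of_nonneg_left ?_ (hc.μ_nonneg x)
      have h1 : mass T ν (fun y => (x, y) ∈ H ∩ Good) ≤
          ∑ P ∈ J x, mass T ν (fun y => (x, y) ∈ H ∧ y ∈ P) :=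
        mass_le_sum_of_cover _ hc.ν_nonneg fun y _ hy => by
          obtain ⟨P, hP, hyP⟩ := hy.2
          exact ⟨P, hP, hy.1, hyP⟩
      have h2 : ∀ P ∈ J x, mass T ν (fun y => (x, y) ∈ H ∧ y ∈ P) ≤
          (G * X ^ 12) ^ N * dyad s (k - l) := by
        intro P hP
        by_cases hex : ∃ y ∈ T, (x, y) ∈ H ∧ y ∈ P
        · obtain ⟨y, hy, hyH, hyP⟩ := hex
          refine (mass_mono hc.ν_nonneg fun z hz h => ⟨h.1, ?_⟩).trans
            (hH _ hyH (k - l) (Nat.sub_le _ _))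
          refine (hdev x hx P hP y hy z hz hyP h.2).trans (le_of_eq ?_)
          have : dyad 1 k = dyad 1 (k - l) * dyad 1 l := by rw [← dyad_add, Nat.sub_add_cancel hkl]
          rw [this, dyad_one l, one_div, inv_pow]
          field_simp
        · rw [mass_eq_zero fun y hy h => hex ⟨y, hy, h⟩]
          exact hR0
      calc _ ≤ (∑ P ∈ J x, mass T ν (fun y => (x, y) ∈ H ∧ y ∈ P)) * dyad τ k :=
            mul_le_mul_of_nonneg_right h1 (dyad_pos τ k).le
        _ ≤ ((J x).card * ((G * X ^ 12) ^ N * dyad s (k - l))) * dyad τ k := by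
          refine mul_le_mul_of_nonneg_right ((Finset.sum_le_sum h2).trans (le_of_eq ?_))
            (dyad_pos τ k).le
          rw [Finset.sum_const, nsmul_eq_mul]
        _ = (J x).card * dyad τ k * ((G * X ^ 12) ^ N * dyad s (k - l)) := by ring
        _ ≤ 1 * _ := mul_le_mul_of_nonneg_right (hJ x hx) hR0
        _ = _ := one_mul _
    refine (Finset.sum_le_sum hx).trans ?_
    rw [← Finset.sum_mul]
    exact (mul_le_mul_of_nonneg_right hc.μ_sum hR0).trans (one_mul _).le
  have hτk := dyad_pos τ k
  have hsk : dyad s (k - l) ≤ 2 ^ l * dyad s k := by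
    have h1 : dyad s k = dyad s (k - l) * dyad s l := by rw [← dyad_add, Nat.sub_add_cancel hkl]
    have h2 := dyad_anti_left hs.le l
    have h3 := dyad_pos s (k - l)
    rw [dyad_one, one_div, inv_pow] at h2
    rw [h1]
    calc _ = 2 ^ l * (dyad s (k - l) * (2 ^ l)⁻¹) := by field_simp
      _ ≤ _ := by gcongr
  have hfin : c ^ 2 / X ^ 4 / 2 * dyad τ k ≤ (G * X ^ 12) ^ N * (2 ^ l * dyad s k) := by
    calc _ ≤ pairMass S T μ ν (H ∩ Good) * dyad τ k := by
          refine mul_le_mul_of_nonneg_right ?_ hτk.le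
          linarith
      _ ≤ _ := hup
      _ ≤ _ := by gcongr
  have hlt := hk₁ k ((le_max_left _ _).trans hk)
  have hdy : dyad s k = dyad (s - τ) k * dyad τ k := by rw [← dyad_exp_add]; congr 1; ring
  rw [hdy] at hfin
  have hfin' : c ^ 2 / X ^ 4 / 2 ≤ (G * X ^ 12) ^ N * (2 ^ l * dyad (s - τ) k) := by
    refine le_of_mul_le_mul_right ?_ hτk
    linarith
  have hpos : 0 < 2 / c ^ 2 * X ^ 4 := by positivity
  have h1 := mul_le_mul_of_nonneg_left hfin' hpos.le
  have h2 : 2 / c ^ 2 * X ^ 4 * (c ^ 2 / X ^ 4 / 2) = 1 := by field_simp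
  have h3 : 2 / c ^ 2 * X ^ 4 * ((G * X ^ 12) ^ N * (2 ^ l * dyad (s - τ) k)) =
      2 / c ^ 2 * G ^ N * 2 ^ l * X ^ (4 + 12 * N) * dyad (s - τ) k := by
    rw [pow_add, pow_mul, mul_pow]; ring
  rw [h2, h3] at h1
  linarith

end bootstrap

/-! ### Dyadic cubes and dyadic content -/

section content

/-- The index of the dyadic square of side `2 ^ (-i)` containing `z`. -/
def dyadicCode (i : ℕ) (z : E2) : ℤ × ℤ := (⌊2 ^ i * z 0⌋, ⌊2 ^ i * z 1⌋)

/-- The dyadic square of level `Q.1` with index `Q.2`. -/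
def dyadicCube (Q : ℕ × (ℤ × ℤ)) : Set E2 := {z | dyadicCode Q.1 z = Q.2}

/-- The union of the dyadic squares of a family. -/
def cubeUnion (𝒞 : Set (ℕ × (ℤ × ℤ))) : Set E2 := ⋃ Q ∈ 𝒞, dyadicCube Q

/-- The discrete measure giving each dyadic square of side `2 ^ (-i)` the mass `2 ^ (-s i)`. -/
def cubeCost (s : ℝ) : Measure (ℕ × (ℤ × ℤ)) :=
  Measure.sum fun Q => ENNReal.ofReal (dyad s Q.1) • Measure.dirac Q

/-- The dyadic `s`-dimensional Hausdorff content. -/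
def dyadicContent (s : ℝ) (A : Set E2) : ℝ≥0∞ :=
  ⨅ (𝒞 : Set (ℕ × (ℤ × ℤ))) (_ : A ⊆ cubeUnion 𝒞), cubeCost s 𝒞

lemma floor_div_two_pow_succ (i : ℕ) (v : ℝ) : ⌊2 ^ i * v⌋ = ⌊2 ^ (i + 1) * v⌋ / 2 := by
  have h := Int.floor_div_natCast (2 ^ (i + 1) * v) 2
  push_cast at h
  rw [← h]
  congr 1
  rw [pow_succ]; ring

lemma dyadicCode_eq_of_le {i j : ℕ} (hij : i ≤ j) {z w : E2} (h : dyadicCode j z = dyadicCode j w) :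
    dyadicCode i z = dyadicCode i w := by
  induction j, hij using Nat.le_induction with
  | base => exact h
  | succ n _ ih =>
    apply ih
    unfold dyadicCode at h ⊢
    rw [Prod.mk.injEq] at h ⊢
    simp only [floor_div_two_pow_succ n, h.1, h.2, and_self]

lemma dyadicCube_subset {Q R : ℕ × (ℤ × ℤ)} (h : Q.1 ≤ R.1) {z : E2} (hQ : z ∈ dyadicCube Q)
    (hR : z ∈ dyadicCube R) : dyadicCube R ⊆ dyadicCube Q := fun w hw => by
  have h1 : dyadicCode R.1 w = dyadicCode R.1 z := Eq.trans hw (Eq.symm hR)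
  exact (dyadicCode_eq_of_le h h1).trans hQ

lemma mem_cubeUnion {𝒞 : Set (ℕ × (ℤ × ℤ))} {z : E2} :
    z ∈ cubeUnion 𝒞 ↔ ∃ Q ∈ 𝒞, z ∈ dyadicCube Q := by simp [cubeUnion]

lemma cubeUnion_mono {𝒞 𝒟 : Set (ℕ × (ℤ × ℤ))} (h : 𝒞 ⊆ 𝒟) : cubeUnion 𝒞 ⊆ cubeUnion 𝒟 :=
  biUnion_subset_biUnion_left h

lemma measurableSet_cubes (𝒞 : Set (ℕ × (ℤ × ℤ))) : MeasurableSet 𝒞 :=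
  𝒞.to_countable.measurableSet

lemma cubeCost_apply (s : ℝ) (𝒞 : Set (ℕ × (ℤ × ℤ))) :
    cubeCost s 𝒞 = ∑' Q : 𝒞, ENNReal.ofReal (dyad s Q.1.1) := by
  rw [cubeCost, Measure.sum_apply _ (measurableSet_cubes 𝒞),
    tsum_subtype 𝒞 fun Q => ENNReal.ofReal (dyad s Q.1)]
  refine tsum_congr fun Q => ?_
  rw [Measure.smul_apply, Measure.dirac_apply' _ (measurableSet_cubes 𝒞)]
  by_cases h : Q ∈ 𝒞 <;> simp [h]

lemma cubeCost_singleton (s : ℝ) (Q : ℕ × (ℤ × ℤ)) :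
    cubeCost s {Q} = ENNReal.ofReal (dyad s Q.1) := by
  rw [cubeCost_apply, tsum_singleton Q fun Q => ENNReal.ofReal (dyad s Q.1)]

lemma dyadicContent_le {s : ℝ} {A : Set E2} {𝒞 : Set (ℕ × (ℤ × ℤ))} (h : A ⊆ cubeUnion 𝒞) :
    dyadicContent s A ≤ cubeCost s 𝒞 := iInf₂_le 𝒞 h

lemma dyadicContent_mono {s : ℝ} {A B : Set E2} (h : A ⊆ B) :
    dyadicContent s A ≤ dyadicContent s B :=
  le_iInf₂ fun _ h𝒞 => dyadicContent_le (h.trans h𝒞)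

lemma dyadicContent_le_of_subset {s : ℝ} {A : Set E2} {Q : ℕ × (ℤ × ℤ)} (h : A ⊆ dyadicCube Q) :
    dyadicContent s A ≤ ENNReal.ofReal (dyad s Q.1) := by
  rw [← cubeCost_singleton]
  exact dyadicContent_le (by simpa [cubeUnion] using h)

lemma dyadicContent_empty (s : ℝ) : dyadicContent s ∅ = 0 :=
  le_antisymm ((dyadicContent_le (empty_subset _)).trans (measure_empty (μ := cubeCost s)).le)
    bot_le

lemma exists_cubeCost_le {s : ℝ} {A : Set E2} {c : ℝ≥0∞} (h : dyadicContent s A < c) :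
    ∃ 𝒞, A ⊆ cubeUnion 𝒞 ∧ cubeCost s 𝒞 < c := by
  simpa [dyadicContent, iInf_lt_iff] using h

lemma dyadicContent_iUnion_le {s : ℝ} {ι : Type*} [Countable ι] (A : ι → Set E2) :
    dyadicContent s (⋃ i, A i) ≤ ∑' i, dyadicContent s (A i) := by
  refine ENNReal.le_of_forall_pos_le_add fun ε hε hfin => ?_
  obtain ⟨ε', hε', hsum⟩ := ENNReal.exists_pos_sum_of_countable (ENNReal.coe_pos.2 hε).ne' ι
  have h : ∀ i, ∃ 𝒞, A i ⊆ cubeUnion 𝒞 ∧ cubeCost s 𝒞 < dyadicContent s (A i) + ε' i := fun i =>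
    exists_cubeCost_le (ENNReal.lt_add_right (ENNReal.ne_top_of_tsum_ne_top hfin.ne i)
      (ENNReal.coe_pos.2 (hε' i)).ne')
  choose 𝒞 h𝒞 hcost using h
  calc _ ≤ cubeCost s (⋃ i, 𝒞 i) := dyadicContent_le <| iUnion_subset fun i =>
        (h𝒞 i).trans (cubeUnion_mono (subset_iUnion _ i))
    _ ≤ ∑' i, cubeCost s (𝒞 i) := measure_iUnion_le _
    _ ≤ ∑' i, (dyadicContent s (A i) + ε' i) := ENNReal.tsum_le_tsum fun i => (hcost i).le
    _ = ∑' i, dyadicContent s (A i) + ∑' i, (ε' i : ℝ≥0∞) := ENNReal.tsum_add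
    _ ≤ _ := by gcongr

lemma dyadicContent_biUnion_finset_le {s : ℝ} {ι : Type*} (I : Finset ι) (A : ι → Set E2) :
    dyadicContent s (⋃ i ∈ I, A i) ≤ ∑ i ∈ I, dyadicContent s (A i) := by
  have h := dyadicContent_iUnion_le (s := s) fun i : I => A i
  rw [Finset.tsum_subtype I fun i => dyadicContent s (A i)] at h
  simpa [iUnion_subtype] using h

/-- The squares of a family that are contained in no strictly larger square of the family. -/
def maximalCubes (𝒞 : Set (ℕ × (ℤ × ℤ))) : Set (ℕ × (ℤ × ℤ)) :=
  {Q | Q ∈ 𝒞 ∧ ∀ R ∈ 𝒞, R.1 < Q.1 → ¬ dyadicCube Q ⊆ dyadicCube R}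

lemma cubeUnion_subset_maximalCubes (𝒞 : Set (ℕ × (ℤ × ℤ))) :
    cubeUnion 𝒞 ⊆ cubeUnion (maximalCubes 𝒞) := fun z hz => by
  classical
  rw [mem_cubeUnion] at hz ⊢
  have hex : ∃ n, ∃ Q ∈ 𝒞, z ∈ dyadicCube Q ∧ Q.1 = n := by
    obtain ⟨Q, hQ, hz⟩ := hz
    exact ⟨Q.1, Q, hQ, hz, rfl⟩
  obtain ⟨Q, hQ, hzQ, hn⟩ := Nat.find_spec hex
  refine ⟨Q, ⟨hQ, fun R hR hlt hsub => ?_⟩, hzQ⟩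
  rw [hn] at hlt
  exact Nat.find_min hex hlt ⟨R, hR, hsub hzQ, rfl⟩

/-- Adding a cover of a larger set to a family of squares. -/
lemma cubeCost_maximalCubes_add_le {s : ℝ} {A : Set E2} {𝒰 𝒞 : Set (ℕ × (ℤ × ℤ))}
    (hU : A ⊆ cubeUnion 𝒰) (hC : A ⊆ cubeUnion 𝒞) :
    cubeCost s (maximalCubes (𝒰 ∪ 𝒞)) + dyadicContent s A ≤
      cubeCost s (maximalCubes 𝒰) + cubeCost s 𝒞 := by
  set 𝒟 := maximalCubes 𝒰
  set 𝒟' := maximalCubes (𝒰 ∪ 𝒞)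
  have hsub : 𝒟' ⊆ 𝒟 ∪ 𝒞 := by
    rintro Q ⟨hQ | hQ, hmax⟩
    · exact Or.inl ⟨hQ, fun R hR => hmax R (Or.inl hR)⟩
    · exact Or.inr hQ
  have hcov : A ⊆ cubeUnion ((𝒟 ∪ 𝒞) \ 𝒟' ∪ 𝒟 ∩ 𝒞) := fun z hz => by
    obtain ⟨Q, hQ, hzQ⟩ := mem_cubeUnion.1 (cubeUnion_subset_maximalCubes _ (hU hz))
    obtain ⟨R, hR, hzR⟩ := mem_cubeUnion.1 (hC hz)
    rw [mem_cubeUnion]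
    rcases lt_trichotomy Q.1 R.1 with h | h | h
    · exact ⟨R, Or.inl ⟨Or.inr hR, fun hR' =>
        hR'.2 Q (Or.inl hQ.1) h (dyadicCube_subset h.le hzQ hzR)⟩, hzR⟩
    · have : Q = R := Prod.ext h (by
        have h1 : dyadicCode Q.1 z = Q.2 := hzQ
        have h2 : dyadicCode R.1 z = R.2 := hzR
        rw [← h1, ← h2, h])
      exact ⟨Q, Or.inr ⟨hQ, this ▸ hR⟩, hzQ⟩
    · exact ⟨Q, Or.inl ⟨Or.inl hQ, fun hQ' =>
        hQ'.2 R (Or.inr hR) h (dyadicCube_subset h.le hzR hzQ)⟩, hzQ⟩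
  calc _ ≤ cubeCost s 𝒟' + (cubeCost s ((𝒟 ∪ 𝒞) \ 𝒟') + cubeCost s (𝒟 ∩ 𝒞)) := by
        gcongr
        exact (dyadicContent_le hcov).trans (measure_union_le _ _)
    _ = cubeCost s (𝒟 ∪ 𝒞) + cubeCost s (𝒟 ∩ 𝒞) := by
      rw [← add_assoc, ← measure_inter_add_sdiff (𝒟 ∪ 𝒞) (measurableSet_cubes 𝒟'),
        inter_eq_right.2 hsub]
    _ = _ := measure_union_add_inter _ (measurableSet_cubes 𝒞)

/-- The dyadic content is continuous along increasing sequences of arbitrary sets. -/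
lemma dyadicContent_iUnion_le_iSup {s : ℝ} {A : ℕ → Set E2} (hA : Monotone A) :
    dyadicContent s (⋃ n, A n) ≤ ⨆ n, dyadicContent s (A n) := by
  rcases eq_or_ne (⨆ n, dyadicContent s (A n)) ⊤ with htop | htop
  · simp [htop]
  have hfin : ∀ n, dyadicContent s (A n) ≠ ⊤ := fun n =>
    ne_top_of_le_ne_top htop (le_iSup (fun n => dyadicContent s (A n)) n)
  refine ENNReal.le_of_forall_pos_le_add fun ε hε _ => ?_
  obtain ⟨ε', hε', hsum⟩ := ENNReal.exists_pos_sum_of_countable (ENNReal.coe_pos.2 hε).ne' ℕ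
  have h : ∀ n, ∃ 𝒞, A n ⊆ cubeUnion 𝒞 ∧ cubeCost s 𝒞 < dyadicContent s (A n) + ε' n := fun n =>
    exists_cubeCost_le (ENNReal.lt_add_right (hfin n) (ENNReal.coe_pos.2 (hε' n)).ne')
  choose 𝒞 h𝒞 hcost using h
  have hacc : ∀ n, A n ⊆ cubeUnion (accumulate 𝒞 n) := fun n =>
    (h𝒞 n).trans (cubeUnion_mono (subset_accumulate (s := 𝒞) (x := n)))
  have hbound : ∀ n, cubeCost s (maximalCubes (accumulate 𝒞 n)) ≤
      dyadicContent s (A n) + ∑ k ∈ Finset.range (n + 1), (ε' k : ℝ≥0∞) := by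
    intro n
    induction n with
    | zero =>
      have : accumulate 𝒞 0 = 𝒞 0 := by ext; simp [accumulate]
      rw [this]
      simpa using (measure_mono fun Q hQ => hQ.1).trans (hcost 0).le
    | succ n ih =>
      have h1 := cubeCost_maximalCubes_add_le (s := s) (hacc n)
        ((hA (Nat.le_succ n)).trans (h𝒞 (n + 1)))
      rw [← accumulate_succ] at h1
      refine (ENNReal.add_le_add_iff_right (hfin n)).1 (h1.trans ?_)
      rw [Finset.sum_range_succ]
      calc _ ≤ (dyadicContent s (A n) + ∑ k ∈ Finset.range (n + 1), (ε' k : ℝ≥0∞)) +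
            (dyadicContent s (A (n + 1)) + ε' (n + 1)) := add_le_add ih (hcost (n + 1)).le
        _ = _ := by ring
  set 𝒟 := maximalCubes (⋃ n, 𝒞 n) with h𝒟
  have hcov : ⋃ n, A n ⊆ cubeUnion 𝒟 := iUnion_subset fun n =>
    (h𝒞 n).trans ((cubeUnion_mono (subset_iUnion _ n)).trans (cubeUnion_subset_maximalCubes _))
  have hD : 𝒟 = ⋃ n, 𝒟 ∩ accumulate 𝒞 n := by
    rw [← inter_iUnion, iUnion_accumulate, inter_eq_left.2 fun Q hQ => hQ.1]
  have hmono : Monotone fun n => 𝒟 ∩ accumulate 𝒞 n := fun m n hmn =>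
    inter_subset_inter_right _ (monotone_accumulate hmn)
  calc _ ≤ cubeCost s 𝒟 := dyadicContent_le hcov
    _ = ⨆ n, cubeCost s (𝒟 ∩ accumulate 𝒞 n) := by
      conv_lhs => rw [hD]
      exact hmono.measure_iUnion
    _ ≤ _ := iSup_le fun n => ?_
  have hsubn : 𝒟 ∩ accumulate 𝒞 n ⊆ maximalCubes (accumulate 𝒞 n) := fun Q hQ =>
    ⟨hQ.2, fun R hR => hQ.1.2 R ((accumulate_subset_iUnion _) hR)⟩
  refine (measure_mono hsubn).trans ((hbound n).trans ?_)
  gcongr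
  · exact le_iSup (fun n => dyadicContent s (A n)) n
  · exact (ENNReal.sum_le_tsum _).trans hsum.le

end content

section capacity

/-- The indices of a dyadic square and its neighbours. -/
def codeNeighbors (c : ℤ × ℤ) : Finset (ℤ × ℤ) :=
  Finset.Icc (c.1 - 1) (c.1 + 1) ×ˢ Finset.Icc (c.2 - 1) (c.2 + 1)

lemma card_codeNeighbors (c : ℤ × ℤ) : (codeNeighbors c).card = 9 := by
  have h : ∀ a : ℤ, a + 1 + 1 - (a - 1) = 3 := fun a => by ring
  simp [codeNeighbors, Finset.card_product, Int.card_Icc, h]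

/-- An open neighbourhood of a dyadic square. -/
def cubeNhd (Q : ℕ × (ℤ × ℤ)) : Set E2 :=
  {z | ((Q.2.1 : ℝ) - 1 < 2 ^ Q.1 * z 0 ∧ 2 ^ Q.1 * z 0 < Q.2.1 + 2) ∧
    ((Q.2.2 : ℝ) - 1 < 2 ^ Q.1 * z 1 ∧ 2 ^ Q.1 * z 1 < Q.2.2 + 2)}

lemma isOpen_cubeNhd (Q : ℕ × (ℤ × ℤ)) : IsOpen (cubeNhd Q) := by
  have h0 : Continuous fun z : E2 => 2 ^ Q.1 * z 0 := by fun_prop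
  have h1 : Continuous fun z : E2 => 2 ^ Q.1 * z 1 := by fun_prop
  exact ((isOpen_lt continuous_const h0).inter (isOpen_lt h0 continuous_const)).inter
    ((isOpen_lt continuous_const h1).inter (isOpen_lt h1 continuous_const))

lemma dyadicCube_subset_cubeNhd (Q : ℕ × (ℤ × ℤ)) : dyadicCube Q ⊆ cubeNhd Q := fun z hz => by
  have h : dyadicCode Q.1 z = Q.2 := hz
  have h0 : ⌊2 ^ Q.1 * z 0⌋ = Q.2.1 := congrArg Prod.fst h
  have h1 : ⌊2 ^ Q.1 * z 1⌋ = Q.2.2 := congrArg Prod.snd h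
  rw [Int.floor_eq_iff] at h0 h1
  refine ⟨⟨?_, ?_⟩, ?_, ?_⟩ <;> linarith [h0.1, h0.2, h1.1, h1.2]

lemma dyadicContent_cubeNhd_le (s : ℝ) (Q : ℕ × (ℤ × ℤ)) :
    dyadicContent s (cubeNhd Q) ≤ 9 * ENNReal.ofReal (dyad s Q.1) := by
  have hcov : cubeNhd Q ⊆ ⋃ c ∈ codeNeighbors Q.2, dyadicCube (Q.1, c) := fun z hz => by
    obtain ⟨⟨h1, h2⟩, h3, h4⟩ := hz
    refine mem_iUnion₂.2 ⟨dyadicCode Q.1 z, ?_, rfl⟩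
    have key : ∀ (a : ℤ) (v : ℝ), (a : ℝ) - 1 < v → v < a + 2 → ⌊v⌋ ∈ Finset.Icc (a - 1) (a + 1) :=
      fun a v hl hu => by
        rw [Finset.mem_Icc]
        constructor
        · rw [Int.le_floor]; push_cast; exact hl.le
        · have : ⌊v⌋ < a + 2 := by rw [Int.floor_lt]; push_cast; exact hu
          omega
    exact Finset.mem_product.2 ⟨key _ _ h1 h2, key _ _ h3 h4⟩
  calc _ ≤ _ := dyadicContent_mono hcov
    _ ≤ ∑ c ∈ codeNeighbors Q.2, dyadicContent s (dyadicCube (Q.1, c)) :=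
      dyadicContent_biUnion_finset_le _ _
    _ ≤ ∑ c ∈ codeNeighbors Q.2, ENNReal.ofReal (dyad s Q.1) :=
      Finset.sum_le_sum fun c _ => dyadicContent_le_of_subset (Q := (Q.1, c)) subset_rfl
    _ = _ := by rw [Finset.sum_const, card_codeNeighbors]; simp

lemma dyadicContent_biUnion_cubeNhd_le (s : ℝ) (𝒞 : Set (ℕ × (ℤ × ℤ))) :
    dyadicContent s (⋃ Q ∈ 𝒞, cubeNhd Q) ≤ 9 * cubeCost s 𝒞 := by
  rw [biUnion_eq_iUnion, cubeCost_apply, ← ENNReal.tsum_mul_left]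
  exact (dyadicContent_iUnion_le _).trans
    (ENNReal.tsum_le_tsum fun Q => dyadicContent_cubeNhd_le s Q.1)

/-- Sequences whose first `m` entries are bounded by those of `n`. -/
def boundedSeq (n : ℕ → ℕ) (m : ℕ) : Set (ℕ → ℕ) := {g | ∀ i < m, g i ≤ n i}

lemma exists_boundedSeq_subset (n : ℕ → ℕ) {U : Set (ℕ → ℕ)} (hU : IsOpen U)
    (h : univ.pi (fun i => Iic (n i)) ⊆ U) : ∃ m, boundedSeq n m ⊆ U := by
  have hK : IsCompact (univ.pi fun i => Iic (n i)) :=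
    isCompact_univ_pi fun i => (finite_Iic (n i)).isCompact
  have hcyl : ∀ g ∈ univ.pi (fun i => Iic (n i)), ∃ m, PiNat.cylinder g m ⊆ U := fun g hg => by
    obtain ⟨_, ⟨x, m, rfl⟩, hgx, hsub⟩ :=
      (PiNat.isTopologicalBasis_cylinders fun _ : ℕ => ℕ).exists_subset_of_mem_open (h hg) hU
    exact ⟨m, by rwa [PiNat.mem_cylinder_iff_eq.1 hgx]⟩
  choose! M hM using hcyl
  obtain ⟨t, htK, ht⟩ := hK.elim_nhds_subcover (fun g => PiNat.cylinder g (M g)) fun g _ =>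
    (PiNat.isOpen_cylinder (fun _ : ℕ => ℕ) g (M g)).mem_nhds (PiNat.self_mem_cylinder g _)
  refine ⟨t.sup M, fun g hg => ?_⟩
  have hmem : (fun i => min (g i) (n i)) ∈ univ.pi (fun i => Iic (n i)) := fun i _ =>
    mem_Iic.2 (min_le_right _ _)
  obtain ⟨x, hx, hgx⟩ := mem_iUnion₂.1 (ht hmem)
  refine hM x (htK x hx) ?_
  rw [PiNat.mem_cylinder_iff] at hgx ⊢
  intro i hi
  rw [← hgx i hi, min_eq_left (hg i (hi.trans_le (Finset.le_sup hx)))]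

lemma exists_lt_dyadicContent_image {s : ℝ} (f : (ℕ → ℕ) → E2) {c : ℝ≥0∞} (D : Set (ℕ → ℕ)) (m : ℕ)
    (h : c < dyadicContent s (f '' D)) :
    ∃ N, c < dyadicContent s (f '' (D ∩ {g | g m ≤ N})) := by
  have hmono : Monotone fun N => f '' (D ∩ {g | g m ≤ N}) := fun N N' hN =>
    image_mono (inter_subset_inter_right _ fun g hg => le_trans hg hN)
  have hU : f '' D = ⋃ N, f '' (D ∩ {g | g m ≤ N}) := by
    rw [← image_iUnion, ← inter_iUnion, inter_eq_left.2]
    exact fun g _ => mem_iUnion.2 ⟨g m, le_refl (g m)⟩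
  rw [hU] at h
  exact lt_iSup_iff.1 (h.trans_le (dyadicContent_iUnion_le_iSup hmono))

lemma exists_forall_lt_dyadicContent_image {s : ℝ} (f : (ℕ → ℕ) → E2) {c : ℝ≥0∞}
    (h : c < dyadicContent s (range f)) :
    ∃ n : ℕ → ℕ, ∀ m, c < dyadicContent s (f '' boundedSeq n m) := by
  choose! N hN using fun D m => exists_lt_dyadicContent_image (s := s) (c := c) f D m
  let D : ℕ → Set (ℕ → ℕ) := fun m => Nat.rec univ (fun m D => D ∩ {g | g m ≤ N D m}) m
  have hD : ∀ m, c < dyadicContent s (f '' D m) := fun m => by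
    induction m with
    | zero => simpa [D] using h
    | succ m ih => exact hN _ m ih
  have hDB : ∀ m, D m = boundedSeq (fun m => N (D m) m) m := fun m => by
    induction m with
    | zero => simp [D, boundedSeq]
    | succ m ih =>
      have : D (m + 1) = D m ∩ {g | g m ≤ N (D m) m} := rfl
      rw [this]
      ext g
      rw [mem_inter_iff]
      conv_lhs => rw [show g ∈ D m ↔ g ∈ boundedSeq (fun m => N (D m) m) m by rw [← ih]]
      simp only [boundedSeq, mem_ofPred_eq, Nat.lt_succ_iff_lt_or_eq]
      constructor
      · rintro ⟨h1, h2⟩ i (hi | rfl)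
        exacts [h1 i hi, h2]
      · exact fun h => ⟨fun i hi => h i (Or.inl hi), h m (Or.inr rfl)⟩
  exact ⟨_, fun m => hDB m ▸ hD m⟩

/-- Analytic sets of positive dyadic content contain compact sets of positive content. -/
lemma exists_isCompact_dyadicContent_pos {s : ℝ} {Y : Set E2} (hY : AnalyticSet Y)
    (h : 0 < dyadicContent s Y) : ∃ K ⊆ Y, IsCompact K ∧ 0 < dyadicContent s K := by
  rw [AnalyticSet] at hY
  rcases hY with rfl | ⟨f, hf, rfl⟩
  · rw [dyadicContent_empty] at h
    exact absurd h (lt_irrefl _)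
  obtain ⟨c, hc0, hc⟩ := exists_between h
  obtain ⟨n, hn⟩ := exists_forall_lt_dyadicContent_image f hc
  refine ⟨f '' univ.pi (fun i => Iic (n i)), image_subset_range _ _,
    (isCompact_univ_pi fun i => (finite_Iic (n i)).isCompact).image hf, ?_⟩
  by_contra hzero
  have hlt : dyadicContent s (f '' univ.pi fun i => Iic (n i)) < c / 9 := by
    rw [nonpos_iff_eq_zero.1 (not_lt.1 hzero)]
    exact ENNReal.div_pos hc0.ne' (by norm_num)
  obtain ⟨𝒞, h𝒞, hcost⟩ := exists_cubeCost_le hlt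
  have hUo : IsOpen (⋃ Q ∈ 𝒞, cubeNhd Q) := isOpen_biUnion fun Q _ => isOpen_cubeNhd Q
  obtain ⟨m, hm⟩ := exists_boundedSeq_subset n (hUo.preimage hf) <| image_subset_iff.1 <|
    h𝒞.trans (iUnion₂_mono fun Q _ => dyadicCube_subset_cubeNhd Q)
  have h1 := (dyadicContent_mono (image_subset_iff.2 hm)).trans
    (dyadicContent_biUnion_cubeNhd_le s 𝒞)
  have h2 : 9 * cubeCost s 𝒞 ≤ c := by
    rw [mul_comm]
    exact (ENNReal.le_div_iff_mul_le (by simp) (by simp)).1 hcost.le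
  exact absurd (hn m) (not_lt.2 (h1.trans h2))

end capacity

section dimension

lemma dyad_eq_rpow (τ : ℝ) (j : ℕ) : dyad τ j = 2 ^ (-τ * j) := by
  rw [dyad, ← Real.rpow_natCast, ← Real.rpow_mul zero_le_two]

lemma dist_le_abs_add_abs (z w : E2) : dist z w ≤ |z 0 - w 0| + |z 1 - w 1| := by
  rw [EuclideanSpace.dist_eq, Fin.sum_univ_two, Real.dist_eq, Real.dist_eq]
  refine Real.sqrt_le_iff.2 ⟨by positivity, ?_⟩
  nlinarith [abs_nonneg (z 0 - w 0), abs_nonneg (z 1 - w 1)]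

lemma two_pow_mul_dyad_one (i : ℕ) : 2 ^ i * dyad 1 i = 1 := by
  rw [dyad_one, ← mul_pow]; norm_num

lemma abs_sub_le_of_floor_eq {i : ℕ} {v w : ℝ} (h : ⌊2 ^ i * v⌋ = ⌊2 ^ i * w⌋) :
    |v - w| ≤ dyad 1 i := by
  have h1 := Int.abs_sub_lt_one_of_floor_eq_floor h
  rw [← mul_sub, abs_mul, abs_of_pos (by positivity : (0 : ℝ) < 2 ^ i)] at h1
  refine le_of_mul_le_mul_left ?_ (by positivity : (0 : ℝ) < 2 ^ i)
  rw [two_pow_mul_dyad_one]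
  exact h1.le

lemma abs_sub_le_of_code_eq {i : ℕ} {z w : E2} (h : dyadicCode i z = dyadicCode i w) :
    |z 0 - w 0| ≤ dyad 1 i ∧ |z 1 - w 1| ≤ dyad 1 i :=
  ⟨abs_sub_le_of_floor_eq (congrArg Prod.fst h), abs_sub_le_of_floor_eq (congrArg Prod.snd h)⟩

lemma ediam_dyadicCube_le (Q : ℕ × (ℤ × ℤ)) :
    ediam (dyadicCube Q) ≤ ENNReal.ofReal (2 * dyad 1 Q.1) := by
  refine ediam_le fun z hz w hw => ?_
  rw [edist_dist]
  refine ENNReal.ofReal_le_ofReal ((dist_le_abs_add_abs z w).trans ?_)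
  have := abs_sub_le_of_code_eq (Eq.trans hz (Eq.symm hw))
  linarith [this.1, this.2]

/-- Sets of large Hausdorff dimension have positive dyadic content. -/
lemma dyadicContent_pos_of_lt_dimH {s : ℝ≥0} (hs : 0 < s) {A : Set E2} (h : (s : ℝ≥0∞) < dimH A) :
    0 < dyadicContent s A := by
  by_contra hzero
  have hs' : (0 : ℝ) < s := hs
  have hcov : ∀ n : ℕ, ∃ 𝒞, A ⊆ cubeUnion 𝒞 ∧ cubeCost s 𝒞 < ENNReal.ofReal (dyad s n) := fun n =>
    exists_cubeCost_le (by
      rw [nonpos_iff_eq_zero.1 (not_lt.1 hzero)]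
      exact ENNReal.ofReal_pos.2 (dyad_pos _ _))
  choose 𝒞 h𝒞 hcost using hcov
  have hlev : ∀ n, ∀ Q ∈ 𝒞 n, n < Q.1 := fun n Q hQ => by
    by_contra! hle
    have h1 : cubeCost s {Q} ≤ cubeCost s (𝒞 n) := measure_mono (singleton_subset_iff.2 hQ)
    rw [cubeCost_singleton] at h1
    exact absurd (hcost n) (not_lt.2 (h1.trans' (ENNReal.ofReal_le_ofReal
      (dyad_anti_right hs'.le hle))))
  classical
  have htend : ∀ τ : ℝ, 0 < τ → Filter.Tendsto (fun n => dyad τ n) Filter.atTop (nhds 0) :=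
    fun τ hτ => tendsto_pow_atTop_nhds_zero_of_lt_one (by positivity)
      (Real.rpow_lt_one_of_one_lt_of_neg one_lt_two (by linarith))
  have hmeas := Measure.hausdorffMeasure_le_liminf_tsum (X := E2) (l := Filter.atTop) (s : ℝ) A
    (fun n : ℕ => ENNReal.ofReal (2 * dyad 1 n)) (by
      rw [← ENNReal.ofReal_zero, ← mul_zero (2 : ℝ)]
      exact ENNReal.tendsto_ofReal ((htend 1 one_pos).const_mul 2))
    (fun n (Q : ℕ × (ℤ × ℤ)) => if Q ∈ 𝒞 n then dyadicCube Q else ∅)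
    (Filter.Eventually.of_forall fun n Q => by
      split_ifs with hQ
      · refine (ediam_dyadicCube_le Q).trans (ENNReal.ofReal_le_ofReal ?_)
        have := dyad_anti_right zero_le_one (hlev n Q hQ).le
        linarith
      · simp)
    (Filter.Eventually.of_forall fun n z hz => by
      obtain ⟨Q, hQ, hzQ⟩ := mem_cubeUnion.1 (h𝒞 n hz)
      exact mem_iUnion.2 ⟨Q, by rwa [if_pos hQ]⟩)
  have hsum : ∀ n, ∑' Q : ℕ × (ℤ × ℤ), ediam (if Q ∈ 𝒞 n then dyadicCube Q else ∅) ^ (s : ℝ) ≤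
      ENNReal.ofReal (2 ^ (s : ℝ) * dyad s n) := fun n => by
    calc _ ≤ ∑' Q : ℕ × (ℤ × ℤ), (𝒞 n).indicator
          (fun Q => ENNReal.ofReal (2 ^ (s : ℝ)) * ENNReal.ofReal (dyad s Q.1)) Q := by
          refine ENNReal.tsum_le_tsum fun Q => ?_
          by_cases hQ : Q ∈ 𝒞 n
          · rw [if_pos hQ, indicator_of_mem hQ, ← ENNReal.ofReal_mul (by positivity)]
            refine (ENNReal.rpow_le_rpow (ediam_dyadicCube_le Q) hs'.le).trans (le_of_eq ?_)
            have h2 := dyad_pos 1 Q.1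
            rw [ENNReal.ofReal_rpow_of_pos (by positivity), Real.mul_rpow zero_le_two h2.le,
              dyad_eq_rpow 1, ← Real.rpow_mul zero_le_two, dyad_eq_rpow]
            congr 3
            ring
          · simp [hQ, hs]
      _ = ENNReal.ofReal (2 ^ (s : ℝ)) * cubeCost s (𝒞 n) := by
        rw [cubeCost_apply, ← tsum_subtype, ENNReal.tsum_mul_left]
      _ ≤ _ := by
        rw [ENNReal.ofReal_mul (by positivity)]
        gcongr
        exact (hcost n).le
  rw [hausdorffMeasure_of_lt_dimH h] at hmeas
  have hlim : Filter.Tendsto (fun n => ENNReal.ofReal (2 ^ (s : ℝ) * dyad s n)) Filter.atTop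
      (nhds 0) := by
    rw [← ENNReal.ofReal_zero, ← mul_zero ((2 : ℝ) ^ (s : ℝ))]
    exact ENNReal.tendsto_ofReal ((htend s hs').const_mul _)
  have hle := hmeas.trans (Filter.liminf_le_liminf (Filter.Eventually.of_forall hsum))
  rw [hlim.liminf_eq] at hle
  exact absurd hle (by simp)

end dimension

section frostman

/-- The indices of the four dyadic squares of the next level inside a dyadic square. -/
def codeChildren (c : ℤ × ℤ) : Finset (ℤ × ℤ) := {2 * c.1, 2 * c.1 + 1} ×ˢ {2 * c.2, 2 * c.2 + 1}

lemma dyadicCode_succ_mem_codeChildren {i : ℕ} {c : ℤ × ℤ} {z : E2} (h : dyadicCode i z = c) :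
    dyadicCode (i + 1) z ∈ codeChildren c := by
  subst h
  have h0 := floor_div_two_pow_succ i (z 0)
  have h1 := floor_div_two_pow_succ i (z 1)
  simp only [codeChildren, dyadicCode, Finset.mem_product, Finset.mem_insert,
    Finset.mem_singleton]
  omega

/-- Weights on subsets of the four children of a dyadic square combine to a weight on their
union. -/
lemma exists_weight_of_children {s : ℝ} {i : ℕ} {A : Set E2} {c : ℤ × ℤ}
    (hA : A ⊆ dyadicCube (i, c)) {m : ℕ}
    (h : ∀ d, ∃ S : Finset E2, (S : Set E2) ⊆ A ∩ dyadicCube (i + 1, d) ∧ ∃ w : E2 → ℝ,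
      (∀ z, 0 ≤ w z) ∧
      (∀ j, i + 1 ≤ j → j ≤ m → ∀ d', mass S w (fun z => dyadicCode j z = d') ≤ dyad s j) ∧
      dyadicContent s (A ∩ dyadicCube (i + 1, d)) ≤ ENNReal.ofReal (∑ z ∈ S, w z)) :
    ∃ S : Finset E2, (S : Set E2) ⊆ A ∧ ∃ w : E2 → ℝ, (∀ z, 0 ≤ w z) ∧
      (∀ j, i + 1 ≤ j → j ≤ m → ∀ d', mass S w (fun z => dyadicCode j z = d') ≤ dyad s j) ∧
      dyadicContent s A ≤ ENNReal.ofReal (∑ z ∈ S, w z) := by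
  classical
  choose S hS w hw hmass hcont using h
  have hcode : ∀ d, ∀ z ∈ S d, dyadicCode (i + 1) z = d := fun d z hz => (hS d hz).2
  have hsum : ∀ f : (ℤ × ℤ) → E2 → ℝ, ∑ z ∈ (codeChildren c).biUnion S, f (dyadicCode (i + 1) z) z =
      ∑ d ∈ codeChildren c, ∑ z ∈ S d, f d z := fun f => by
    rw [Finset.sum_biUnion]
    · exact Finset.sum_congr rfl fun d _ => Finset.sum_congr rfl fun z hz => by rw [hcode d z hz]
    · intro d _ d' _ hdd'
      refine Finset.disjoint_left.2 fun z hz hz' => hdd' ?_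
      rw [← hcode d z hz, hcode d' z hz']
  refine ⟨(codeChildren c).biUnion S, fun z hz => ?_, fun z => w (dyadicCode (i + 1) z) z,
    fun z => hw _ z, fun j hij hjm d' => ?_, ?_⟩
  · obtain ⟨d, -, hz⟩ := Finset.mem_biUnion.1 hz
    exact (hS d hz).1
  · have h1 : mass ((codeChildren c).biUnion S) (fun z => w (dyadicCode (i + 1) z) z)
        (fun z => dyadicCode j z = d') =
          ∑ d ∈ codeChildren c, mass (S d) (w d) (fun z => dyadicCode j z = d') :=
      hsum fun d z => @ite _ (dyadicCode j z = d') (Classical.propDecidable _) (w d z) 0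
    by_cases hex : ∃ z ∈ (codeChildren c).biUnion S, dyadicCode j z = d'
    · obtain ⟨z₀, hz₀, hd'⟩ := hex
      obtain ⟨d₀, hd₀, hz₀⟩ := Finset.mem_biUnion.1 hz₀
      rw [h1, Finset.sum_eq_single_of_mem d₀ hd₀ fun d _ hne => mass_eq_zero fun z hz hzd => hne ?_]
      · exact hmass d₀ j hij hjm d'
      · rw [← hcode d z hz, ← hcode d₀ z₀ hz₀]
        exact dyadicCode_eq_of_le hij (hzd.trans hd'.symm)
    · push Not at hex
      rw [mass_eq_zero hex]
      exact (dyad_pos s j).le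
  · have hcov : A ⊆ ⋃ d ∈ codeChildren c, A ∩ dyadicCube (i + 1, d) := fun z hz =>
      mem_iUnion₂.2 ⟨_, dyadicCode_succ_mem_codeChildren (hA hz), hz, rfl⟩
    rw [hsum w, ENNReal.ofReal_sum_of_nonneg fun d _ => Finset.sum_nonneg fun z _ => hw d z]
    exact (dyadicContent_mono hcov).trans ((dyadicContent_biUnion_finset_le _ _).trans
      (Finset.sum_le_sum fun d _ => hcont d))

/-- The discrete Frostman lemma inside a dyadic square. -/
lemma exists_weight_dyadicCube (s : ℝ) (n : ℕ) : ∀ {i : ℕ} {A : Set E2} {c : ℤ × ℤ},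
    A ⊆ dyadicCube (i, c) → ∃ S : Finset E2, (S : Set E2) ⊆ A ∧ ∃ w : E2 → ℝ, (∀ z, 0 ≤ w z) ∧
      (∀ j, i ≤ j → j ≤ i + n → ∀ d', mass S w (fun z => dyadicCode j z = d') ≤ dyad s j) ∧
      dyadicContent s A ≤ ENNReal.ofReal (∑ z ∈ S, w z) := by
  induction n with
  | zero =>
    intro i A c hA
    rcases A.eq_empty_or_nonempty with rfl | ⟨z₀, hz₀⟩
    · refine ⟨∅, by simp, fun _ => 0, fun _ => le_rfl, fun j _ _ d' => ?_, ?_⟩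
      · rw [mass_eq_zero (by simp)]
        exact (dyad_pos s j).le
      · simp [dyadicContent_empty]
    · refine ⟨{z₀}, by simpa using hz₀, fun _ => dyad s i, fun _ => (dyad_pos s i).le,
        fun j hj hj' d' => ?_, ?_⟩
      · obtain rfl : j = i := by omega
        exact (mass_le_sum fun _ => (dyad_pos s j).le).trans_eq (Finset.sum_singleton _ _)
      · rw [Finset.sum_singleton]
        exact dyadicContent_le_of_subset hA
  | succ n ih =>
    intro i A c hA
    obtain ⟨S, hS, w, hw, hmass, hcont⟩ := exists_weight_of_children (s := s) hA (m := i + (n + 1))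
      fun d => by
        obtain ⟨S, hS, w, hw, hmass, hcont⟩ :=
          ih (i := i + 1) (A := A ∩ dyadicCube (i + 1, d)) (c := d) inter_subset_right
        exact ⟨S, hS, w, hw, fun j hj hj' => hmass j hj (by omega), hcont⟩
    rcases le_or_gt (∑ z ∈ S, w z) (dyad s i) with hle | hlt
    · refine ⟨S, hS, w, hw, fun j hj hj' d' => ?_, hcont⟩
      rcases hj.eq_or_lt with rfl | hj
      · exact (mass_le_sum hw).trans hle
      · exact hmass j hj hj' d'
    · have hd := dyad_pos s i
      have ht : 0 < ∑ z ∈ S, w z := hd.trans hlt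
      set r := dyad s i / ∑ z ∈ S, w z
      have hr0 : 0 ≤ r := by positivity
      have hr1 : r ≤ 1 := (div_le_one ht).2 hlt.le
      have hsum : ∑ z ∈ S, w z * r = dyad s i := by
        rw [← Finset.sum_mul]
        exact mul_div_cancel₀ _ ht.ne'
      refine ⟨S, hS, fun z => w z * r, fun z => mul_nonneg (hw z) hr0, fun j hj hj' d' => ?_, ?_⟩
      · rcases hj.eq_or_lt with rfl | hj
        · exact (mass_le_sum fun z => mul_nonneg (hw z) hr0).trans hsum.le
        · rw [mass_mul_const]
          exact (mul_le_of_le_one_right (mass_nonneg hw) hr1).trans (hmass j hj hj' d')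
      · rw [hsum]
        exact dyadicContent_le_of_subset hA

lemma floor_mem_Icc_of_abs_sub_le {i : ℕ} {v w : ℝ} (h : |w - v| ≤ dyad 1 i) :
    ⌊2 ^ i * w⌋ ∈ Finset.Icc (⌊2 ^ i * v⌋ - 1) (⌊2 ^ i * v⌋ + 1) := by
  have h1 : |2 ^ i * w - 2 ^ i * v| ≤ 1 := by
    rw [← mul_sub, abs_mul, abs_of_pos (by positivity : (0 : ℝ) < 2 ^ i), ← two_pow_mul_dyad_one i]
    gcongr
  obtain ⟨h2, h3⟩ := abs_le.1 h1
  rw [Finset.mem_Icc, ← Int.floor_sub_one, ← Int.floor_add_one]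
  exact ⟨Int.floor_le_floor (by linarith), Int.floor_le_floor (by linarith)⟩

/-- The discrete Frostman lemma for subsets of a dyadic square, with ball conditions. -/
lemma exists_frostman_weight {s : ℝ} (hs : 0 ≤ s) {i : ℕ} {A : Set E2} {c : ℤ × ℤ}
    (hA : A ⊆ dyadicCube (i, c)) (k : ℕ) :
    ∃ S : Finset E2, (S : Set E2) ⊆ A ∧ ∃ w : E2 → ℝ, (∀ z, 0 ≤ w z) ∧ ∑ z ∈ S, w z ≤ 1 ∧
      (∀ j ≤ k, ∀ x : E2, mass S w (fun z => |z 0 - x 0| ≤ dyad 1 j ∧ |z 1 - x 1| ≤ dyad 1 j) ≤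
        9 * dyad s j) ∧
      dyadicContent s A ≤ ENNReal.ofReal (∑ z ∈ S, w z) := by
  obtain ⟨S, hS, w, hw, hmass, hcont⟩ := exists_weight_dyadicCube s k hA
  have htot : ∑ z ∈ S, w z ≤ dyad s i := by
    refine le_trans ?_ (hmass i le_rfl (by omega) c)
    rw [← mass_true]
    exact mass_mono hw fun z hz _ => hA (hS hz)
  refine ⟨S, hS, w, hw, htot.trans (dyad_le_one hs i), fun j hj x => ?_, hcont⟩
  have hmass' : ∀ d', mass S w (fun z => dyadicCode j z = d') ≤ dyad s j := fun d' => by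
    rcases le_or_gt i j with hij | hij
    · exact hmass j hij (by omega) d'
    · exact (mass_le_sum hw).trans (htot.trans (dyad_anti_right hs hij.le))
  calc _ ≤ ∑ d ∈ codeNeighbors (dyadicCode j x), mass S w (fun z => dyadicCode j z = d) :=
        mass_le_sum_of_cover _ hw fun z _ hz => ⟨dyadicCode j z, Finset.mem_product.2
          ⟨floor_mem_Icc_of_abs_sub_le hz.1, floor_mem_Icc_of_abs_sub_le hz.2⟩, rfl⟩
    _ ≤ ∑ d ∈ codeNeighbors (dyadicCode j x), dyad s j := Finset.sum_le_sum fun d _ => hmass' d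
    _ = _ := by rw [Finset.sum_const, card_codeNeighbors]; simp

end frostman

/-! ### Covers of sets of directions -/

section directions

/-- The directions of `A` seen from `x` are covered, for each level `k` between `k₀` and `m`, by at
most `2 ^ (τ k)` arcs of length comparable to `2 ^ (-k)`. -/
def DirectionCover (A : Set E2) (τ : ℝ) (k₀ m : ℕ) (x : E2) (J : ℕ → Finset (Set E2)) : Prop :=
  (∀ k, ((J k).card : ℝ) * dyad τ k ≤ 1) ∧
  (∀ k, ∀ P ∈ J k, ∀ y ∈ P, ∀ z ∈ P, dist (radProj x z) (radProj x y) ≤ 3 * dyad 1 k) ∧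
  ∀ y ∈ A, ∃ k ∈ Finset.Icc k₀ m, ∃ P ∈ J k, y ∈ P

lemma DirectionCover.mono {A B : Set E2} {τ : ℝ} {k₀ m n : ℕ} {x : E2} {J : ℕ → Finset (Set E2)}
    (h : DirectionCover A τ k₀ m x J) (hB : B ⊆ A) (hmn : m ≤ n) : DirectionCover B τ k₀ n x J :=
  ⟨h.1, h.2.1, fun y hy => by
    obtain ⟨k, hk, hP⟩ := h.2.2 y (hB hy)
    exact ⟨k, Finset.Icc_subset_Icc_right hmn hk, hP⟩⟩

lemma continuousOn_radProj {K : Set E2} {x : E2} (hx : x ∉ K) : ContinuousOn (radProj x) K := by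
  have h : ContinuousOn (fun y => y - x) K := by fun_prop
  exact (h.norm.inv₀ fun y hy => norm_ne_zero_iff.2 (sub_ne_zero.2 fun e => hx (e ▸ hy))).smul h

lemma dist_le_of_mem_thickening {t : Set E2} {r : ℝ} (hr : 0 < r) (ht : ediam t ≤ ENNReal.ofReal r)
    {y z : E2} (hy : y ∈ thickening r t) (hz : z ∈ thickening r t) : dist z y ≤ 3 * r := by
  obtain ⟨y', hy', hyy⟩ := mem_thickening_iff.1 hy
  obtain ⟨z', hz', hzz⟩ := mem_thickening_iff.1 hz
  have h1 : dist z' y' ≤ r := by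
    have := (edist_le_ediam_of_mem hz' hy').trans ht
    rwa [edist_dist, ENNReal.ofReal_le_ofReal_iff hr.le] at this
  have h2 := dist_triangle4 z z' y' y
  rw [dist_comm y' y] at h2
  linarith

/-- A set of small dimension has countable covers of small cost by sets of dyadic diameters. -/
lemma exists_dyadic_cover_of_dimH_lt {A : Set E2} {τ : ℝ≥0} (h : dimH A < τ) (k₀ : ℕ) :
    ∃ t : ℕ → Set E2, ∃ k : ℕ → ℕ, A ⊆ ⋃ n, t n ∧ (∀ n, k₀ ≤ k n) ∧
      (∀ n, ediam (t n) ≤ ENNReal.ofReal (dyad 1 (k n))) ∧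
      ∑' n, ENNReal.ofReal (dyad τ (k n)) ≤ 1 := by
  have hτ : (0 : ℝ) < τ := by
    have : (0 : ℝ≥0∞) < τ := pos_of_gt h
    exact_mod_cast this
  have hη : 0 < ENNReal.ofReal (dyad τ (k₀ + 1)) / 2 :=
    ENNReal.half_pos (ENNReal.ofReal_pos.2 (dyad_pos _ _)).ne'
  have h0 := hausdorffMeasure_of_dimH_lt h
  rw [Measure.hausdorffMeasure_apply] at h0
  have h1 := (le_iSup₂ (f := fun (r : ℝ≥0∞) (_ : 0 < r) => ⨅ (t : ℕ → Set E2) (_ : A ⊆ ⋃ n, t n)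
    (_ : ∀ n, ediam (t n) ≤ r), ∑' n, ⨆ _ : (t n).Nonempty, ediam (t n) ^ (τ : ℝ))
    1 one_pos).trans (h0.le.trans bot_le) |>.trans_lt hη
  simp only [iInf_lt_iff] at h1
  obtain ⟨t, hAt, -, hsum⟩ := h1
  obtain ⟨ε, hε, hεsum⟩ := ENNReal.exists_pos_sum_of_countable hη.ne' ℕ
  have hdiam : ∀ n, (⨆ _ : (t n).Nonempty, ediam (t n) ^ (τ : ℝ)) = ediam (t n) ^ (τ : ℝ) :=
    fun n => by
      rcases (t n).eq_empty_or_nonempty with he | hne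
      · simp [he, hτ]
      · simp [hne]
  simp_rw [hdiam] at hsum
  set e : ℕ → ℝ≥0∞ := fun n => ediam (t n) ^ (τ : ℝ) + ε n
  have hesum : ∑' n, e n < ENNReal.ofReal (dyad τ (k₀ + 1)) := by
    rw [ENNReal.tsum_add]
    exact (ENNReal.add_lt_add hsum hεsum).trans_eq (ENNReal.add_halves _)
  have hen : ∀ n, e n < ENNReal.ofReal (dyad τ (k₀ + 1)) := fun n =>
    (ENNReal.le_tsum n).trans_lt hesum
  have hlev : ∀ n, ∃ k, ENNReal.ofReal (dyad τ (k + 1)) < e n ∧ e n ≤ ENNReal.ofReal (dyad τ k) :=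
    fun n => by
      have hfin : e n ≠ ⊤ := (hen n).ne_top
      have hpos : 0 < (e n).toReal := ENNReal.toReal_pos
        ((ENNReal.coe_pos.2 (hε n)).trans_le le_add_self).ne' hfin
      have hle : (e n).toReal ≤ 1 := ENNReal.toReal_le_of_le_ofReal zero_le_one
        ((hen n).le.trans (ENNReal.ofReal_le_ofReal (dyad_le_one hτ.le _)))
      obtain ⟨k, hk1, hk2⟩ := exists_nat_pow_near_of_lt_one hpos hle
        (by positivity : (0 : ℝ) < 2 ^ (-(τ : ℝ)))
        (Real.rpow_lt_one_of_one_lt_of_neg one_lt_two (by linarith))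
      exact ⟨k, (ENNReal.ofReal_lt_iff_lt_toReal (dyad_pos _ _).le hfin).2 hk1,
        (ENNReal.le_ofReal_iff_toReal_le hfin (dyad_pos _ _).le).2 hk2⟩
  choose k hk1 hk2 using hlev
  refine ⟨t, k, hAt, fun n => ?_, fun n => ?_, ?_⟩
  · by_contra! hlt
    have h2 := (hk1 n).trans (hen n)
    rw [ENNReal.ofReal_lt_ofReal_iff (dyad_pos _ _)] at h2
    exact absurd h2 (not_lt.2 (dyad_anti_right hτ.le (by omega)))
  · have h2 : ediam (t n) ^ (τ : ℝ) ≤ ENNReal.ofReal (dyad 1 (k n)) ^ (τ : ℝ) := by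
      rw [ENNReal.ofReal_rpow_of_pos (dyad_pos _ _), dyad_eq_rpow 1, ← Real.rpow_mul zero_le_two,
        show -1 * (k n : ℝ) * τ = -τ * k n by ring, ← dyad_eq_rpow]
      exact le_self_add.trans (hk2 n)
    exact (ENNReal.rpow_le_rpow_iff hτ).1 h2
  · have h3 : (∑' n, ENNReal.ofReal (dyad τ (k n))) * ENNReal.ofReal (dyad τ 1) ≤
        1 * ENNReal.ofReal (dyad τ 1) := by
      rw [← ENNReal.tsum_mul_right]
      simp_rw [← ENNReal.ofReal_mul (dyad_pos _ _).le, ← dyad_add, one_mul]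
      exact (ENNReal.tsum_le_tsum fun n => (hk1 n).le).trans
        (hesum.le.trans (ENNReal.ofReal_le_ofReal (dyad_anti_right hτ.le (by omega))))
    exact (ENNReal.mul_le_mul_iff_left (ENNReal.ofReal_pos.2 (dyad_pos _ _)).ne'
      ENNReal.ofReal_ne_top).1 h3

lemma exists_directionCover {K : Set E2} (hK : IsCompact K) {x : E2} (hx : x ∉ K) {τ : ℝ≥0}
    (h : dimH (radProj x '' K) < τ) (k₀ : ℕ) : ∃ m J, DirectionCover K τ k₀ m x J := by
  classical
  obtain ⟨t, k, hcov, hk₀, hdiam, hsum⟩ := exists_dyadic_cover_of_dimH_lt h k₀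
  obtain ⟨F, hF⟩ := (hK.image_of_continuousOn (continuousOn_radProj hx)).elim_finite_subcover
    (fun n => thickening (dyad 1 (k n)) (t n)) (fun n => isOpen_thickening)
    (hcov.trans (iUnion_mono fun n => self_subset_thickening (dyad_pos _ _) _))
  refine ⟨F.sup k, fun i => (F.filter fun n => k n = i).image
    fun n => radProj x ⁻¹' thickening (dyad 1 (k n)) (t n), fun i => ?_, fun i P hP y hy z hz => ?_,
    fun y hy => ?_⟩
  · have h1 : ∑ n ∈ F.filter (fun n => k n = i), dyad τ (k n) ≤ 1 := by
      rw [← ENNReal.ofReal_le_one, ENNReal.ofReal_sum_of_nonneg fun n _ => (dyad_pos _ _).le]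
      exact (ENNReal.sum_le_tsum _).trans hsum
    rw [Finset.sum_congr rfl fun n hn => by rw [(Finset.mem_filter.1 hn).2], Finset.sum_const,
      nsmul_eq_mul] at h1
    refine le_trans (mul_le_mul_of_nonneg_right ?_ (dyad_pos _ _).le) h1
    exact_mod_cast Finset.card_image_le
  · obtain ⟨n, hn, rfl⟩ := Finset.mem_image.1 hP
    obtain rfl := (Finset.mem_filter.1 hn).2
    exact dist_le_of_mem_thickening (dyad_pos _ _) (hdiam n) hy hz
  · obtain ⟨n, hn, hy⟩ := mem_iUnion₂.1 (hF (mem_image_of_mem _ hy))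
    exact ⟨k n, Finset.mem_Icc.2 ⟨hk₀ n, Finset.le_sup hn⟩, _,
      Finset.mem_image_of_mem _ (Finset.mem_filter.2 ⟨hn, rfl⟩), hy⟩

lemma norm_mul_radProj (x z : E2) (j : Fin 2) : ‖z - x‖ * radProj x z j = z j - x j := by
  rcases eq_or_ne z x with rfl | hne
  · simp
  · have := norm_ne_zero_iff.2 (sub_ne_zero.2 hne)
    simp only [radProj, PiLp.smul_apply, PiLp.sub_apply, smul_eq_mul]
    field_simp

/-- The deviation from a line is controlled by the distance of the directions. -/
lemma lineDev_le_dist_radProj {j j' : Fin 2} {x y z : E2} (hne : x j ≠ y j) :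
    lineDev (fun z : E2 => z j) (fun z : E2 => z j') x y z ≤
      dist z x * ((1 + |lineSlope (fun z : E2 => z j) (fun z : E2 => z j') x y|) *
        dist (radProj x z) (radProj x y)) := by
  set a := lineSlope (fun z : E2 => z j) (fun z : E2 => z j') x y with ha
  have h1 : y j' - x j' = a * (y j - x j) := by
    rw [ha, lineSlope]
    exact (div_mul_cancel₀ _ (sub_ne_zero.2 hne.symm)).symm
  have hnorm : ‖y - x‖ ≠ 0 := norm_ne_zero_iff.2 (sub_ne_zero.2 fun e => hne (by rw [e]))
  have h2 : radProj x y j' = a * radProj x y j := by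
    refine mul_left_cancel₀ hnorm ?_
    rw [norm_mul_radProj, h1, ← norm_mul_radProj]
    ring
  set v := radProj x z - radProj x y with hv
  have h3 : z j' - x j' - a * (z j - x j) = ‖z - x‖ * (v j' - a * v j) := by
    rw [← norm_mul_radProj, ← norm_mul_radProj x z j, hv, PiLp.sub_apply, PiLp.sub_apply, h2]
    ring
  have h4 : ∀ i, |v i| ≤ ‖v‖ := fun i => by
    rw [← Real.norm_eq_abs]
    exact PiLp.norm_apply_le v i
  rw [lineDev, ← ha, h3, abs_mul, abs_norm, dist_eq_norm, dist_eq_norm]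
  refine mul_le_mul_of_nonneg_left ?_ (norm_nonneg _)
  calc |v j' - a * v j| ≤ |v j'| + |a * v j| := abs_sub _ _
    _ = |v j'| + |a| * |v j| := by rw [abs_mul]
    _ ≤ ‖v‖ + |a| * ‖v‖ := by gcongr <;> exact h4 _
    _ = _ := by ring

end directions

/-! ### Visibility of transversal sets -/

section visibility

lemma sum_div_add_two_sq_le (c : ℝ) (hc : 0 ≤ c) (a b : ℕ) :
    ∑ k ∈ Finset.Icc a b, c / ((k : ℝ) + 2) ^ 2 ≤ c := by
  have h : ∀ n : ℕ, ∑ k ∈ Finset.range n, c / ((k : ℝ) + 2) ^ 2 ≤ c - c / (n + 1) := fun n => by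
    induction n with
    | zero => simp
    | succ n ih =>
      rw [Finset.sum_range_succ]
      have h1 : c / ((n : ℝ) + 2) ^ 2 ≤ c / (n + 1) - c / (n + 2) := by
        rw [div_sub_div _ _ (by positivity) (by positivity)]
        rw [show c * ((n : ℝ) + 2) - (n + 1) * c = c by ring]
        refine div_le_div_of_nonneg_left hc (by positivity) ?_
        nlinarith [(n.cast_nonneg : (0 : ℝ) ≤ n)]
      push_cast
      rw [show (n : ℝ) + 1 + 1 = n + 2 by ring]
      linarith
  refine (Finset.sum_le_sum_of_subset_of_nonneg (t := Finset.range (b + 1)) (fun k hk => ?_)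
    fun k _ _ => by positivity).trans ((h _).trans (sub_le_self _ (by positivity)))
  rw [Finset.mem_Icc] at hk
  exact Finset.mem_range.2 (by omega)

lemma abs_sub_le_of_coordDist_le {j j' : Fin 2} (hj : j ≠ j') {x z : E2} {r : ℝ}
    (h : coordDist (fun z : E2 => z j) (fun z : E2 => z j') x z ≤ r) :
    |z 0 - x 0| ≤ r ∧ |z 1 - x 1| ≤ r := by
  obtain ⟨h1, h2⟩ := max_le_iff.1 h
  fin_cases j <;> fin_cases j' <;> simp_all

/-- Two sets uniformly transversal to a coordinate direction. -/
structure TransversalSets (j j' : Fin 2) (L D : ℝ) (X A : Set E2) : Prop where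
  ne : ∀ x ∈ X, ∀ y ∈ A, x j ≠ y j
  slope_le : ∀ x ∈ X, ∀ y ∈ A, |lineSlope (fun z : E2 => z j) (fun z : E2 => z j') x y| ≤ L
  diam_left : ∀ x ∈ X, ∀ z ∈ X, |z j - x j| ≤ D
  diam_cross : ∀ x ∈ X, ∀ z ∈ A, |z j - x j| ≤ D

lemma TransversalSets.dist_le {j j' : Fin 2} (hj : j ≠ j') {L D : ℝ} (hL : 0 ≤ L) {X A : Set E2}
    (h : TransversalSets j j' L D X A) {x z : E2} (hx : x ∈ X) (hz : z ∈ A) :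
    dist z x ≤ (1 + L) * D := by
  have h1 := h.diam_cross x hx z hz
  have h2 : |z j' - x j'| ≤ L * D := by
    have h3 : z j' - x j' =
        lineSlope (fun z : E2 => z j) (fun z : E2 => z j') x z * (z j - x j) :=
      (div_mul_cancel₀ _ (sub_ne_zero.2 (h.ne x hx z hz).symm)).symm
    rw [h3, abs_mul]
    exact mul_le_mul (h.slope_le x hx z hz) h1 (abs_nonneg _) hL
  have h4 := dist_le_abs_add_abs z x
  have h5 : |z 0 - x 0| + |z 1 - x 1| = |z j - x j| + |z j' - x j'| := by
    fin_cases j <;> fin_cases j' <;> simp_all [add_comm]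
  linarith

/-- The Frostman weights on discretizations of transversal sets form a Frostman pair. -/
lemma TransversalSets.frostmanPair {j j' : Fin 2} (hj : j ≠ j') {L D : ℝ} {X A : Set E2}
    (h : TransversalSets j j' L D X A) {S T : Finset E2} (hS : (S : Set E2) ⊆ X)
    (hT : (T : Set E2) ⊆ A) {μ ν : E2 → ℝ} (hμ : ∀ z, 0 ≤ μ z) (hν : ∀ z, 0 ≤ ν z)
    (hμs : ∑ z ∈ S, μ z ≤ 1) (hνs : ∑ z ∈ T, ν z ≤ 1) {u s : ℝ} {k : ℕ}
    (hμb : ∀ i ≤ k, ∀ x : E2,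
      mass S μ (fun z => |z 0 - x 0| ≤ dyad 1 i ∧ |z 1 - x 1| ≤ dyad 1 i) ≤ 9 * dyad u i)
    (hνb : ∀ i ≤ k, ∀ x : E2,
      mass T ν (fun z => |z 0 - x 0| ≤ dyad 1 i ∧ |z 1 - x 1| ≤ dyad 1 i) ≤ 9 * dyad s i) :
    FrostmanPair (fun z : E2 => z j) (fun z : E2 => z j') S T μ ν L D 9 u s k where
  μ_nonneg := hμ
  ν_nonneg := hν
  μ_sum := hμs
  ν_sum := hνs
  slope_le x hx y hy := h.slope_le x (hS hx) y (hT hy)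
  ne x hx y hy := h.ne x (hS hx) y (hT hy)
  diam_left x hx z hz := h.diam_left x (hS hx) z (hS hz)
  diam_cross x hx z hz := h.diam_cross x (hS hx) z (hT hz)
  μ_ball x _ i hi := (mass_mono hμ fun _ _ => abs_sub_le_of_coordDist_le hj).trans (hμb i hi x)
  ν_ball x _ i hi := (mass_mono hν fun _ _ => abs_sub_le_of_coordDist_le hj).trans (hνb i hi x)

/-- Among the points seeing few directions at each level of a cover, many see at a single level a
large portion of the weight. -/
lemma exists_level_of_directionCover {A : Set E2} {τ u c : ℝ} (hc : 0 ≤ c) {k₀ m : ℕ}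
    {X : Set E2} {J : E2 → ℕ → Finset (Set E2)} (hJ : ∀ x ∈ X, DirectionCover A τ k₀ m x (J x))
    {T : Finset E2} (hT : (T : Set E2) ⊆ A) {ν : E2 → ℝ} (hν : ∀ z, 0 ≤ ν z)
    (hνc : c < ∑ z ∈ T, ν z) (hX : ENNReal.ofReal c < dyadicContent u X) :
    ∃ k ∈ Finset.Icc k₀ m, ENNReal.ofReal (c / ((k : ℝ) + 2) ^ 2) ≤ dyadicContent u
      {x ∈ X | c / ((k : ℝ) + 2) ^ 2 ≤ mass T ν (fun y => ∃ P ∈ J x k, y ∈ P)} := by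
  by_contra! hsmall
  have hcov : X ⊆ ⋃ k ∈ Finset.Icc k₀ m,
      {x ∈ X | c / ((k : ℝ) + 2) ^ 2 ≤ mass T ν (fun y => ∃ P ∈ J x k, y ∈ P)} := fun x hx => by
    by_contra hnot
    have hlt : ∀ k ∈ Finset.Icc k₀ m,
        mass T ν (fun y => ∃ P ∈ J x k, y ∈ P) ≤ c / ((k : ℝ) + 2) ^ 2 := fun k hk => by
      by_contra! hgt
      exact hnot (mem_iUnion₂.2 ⟨k, hk, hx, hgt.le⟩)
    have h1 : mass T ν (fun _ => True) ≤
        ∑ k ∈ Finset.Icc k₀ m, mass T ν (fun y => ∃ P ∈ J x k, y ∈ P) :=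
      mass_le_sum_of_cover _ hν fun y hy _ => (hJ x hx).2.2 y (hT hy)
    rw [mass_true] at h1
    exact absurd (h1.trans ((Finset.sum_le_sum hlt).trans (sum_div_add_two_sq_le c hc k₀ m)))
      (not_le.2 hνc)
  refine absurd hX (not_lt.2 ?_)
  refine (dyadicContent_mono hcov).trans ((dyadicContent_biUnion_finset_le _ _).trans
    ((Finset.sum_le_sum fun k hk => (hsmall k hk).le).trans ?_))
  rw [← ENNReal.ofReal_sum_of_nonneg fun k _ => by positivity]
  exact ENNReal.ofReal_le_ofReal (sum_div_add_two_sq_le c hc k₀ m)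

lemma exists_directionCover_lt_dyadicContent {X A : Set E2} {τ u : ℝ} {k₀ : ℕ}
    (hcov : ∀ x ∈ X, ∃ m J, DirectionCover A τ k₀ m x J) {b : ℝ≥0∞} (hb : b < dyadicContent u X) :
    ∃ m, b < dyadicContent u {x ∈ X | ∃ J, DirectionCover A τ k₀ m x J} := by
  have hmono : Monotone fun m => {x ∈ X | ∃ J, DirectionCover A τ k₀ m x J} :=
    fun m n hmn x ⟨hx, J, hJ⟩ => ⟨hx, J, hJ.mono subset_rfl hmn⟩
  have hX : X ⊆ ⋃ m, {x ∈ X | ∃ J, DirectionCover A τ k₀ m x J} := fun x hx => by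
    obtain ⟨m, hm⟩ := hcov x hx
    exact mem_iUnion.2 ⟨m, hx, hm⟩
  exact lt_iSup_iff.1 (hb.trans_le ((dyadicContent_mono hX).trans
    (dyadicContent_iUnion_le_iSup hmono)))

/-- The points from which a set `A` of positive `s`-dimensional content has fewer than
`s`-dimensional directions have `u`-dimensional content zero for `u > 1`. -/
theorem TransversalSets.dyadicContent_eq_zero {j j' : Fin 2} (hj : j ≠ j') {L D τ s u : ℝ}
    (hL : 0 ≤ L) (hD : 1 ≤ D) (hτ : 0 ≤ τ) (hτs : τ < s) (hs : s < 1) (hu1 : 1 < u) (hu : u ≤ 2)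
    {X A : Set E2} (h : TransversalSets j j' L D X A) {i i' : ℕ} {d d' : ℤ × ℤ}
    (hX : X ⊆ dyadicCube (i, d)) (hA : A ⊆ dyadicCube (i', d'))
    (hcov : ∀ k₀, ∀ x ∈ X, ∃ m J, DirectionCover A τ k₀ m x J) (hpos : 0 < dyadicContent s A) :
    dyadicContent u X = 0 := by
  by_contra hne
  obtain ⟨c₁, hc₁, hc₁X⟩ := ENNReal.lt_iff_exists_nnreal_btwn.1 (pos_iff_ne_zero.2 hne)
  obtain ⟨c₂, hc₂, hc₂A⟩ := ENNReal.lt_iff_exists_nnreal_btwn.1 hpos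
  rw [ENNReal.coe_pos] at hc₁ hc₂
  set c : ℝ := min (min c₁ c₂) 1
  have hc0 : 0 < c := lt_min (lt_min hc₁ hc₂) one_pos
  have hcc₁ : ENNReal.ofReal c ≤ c₁ :=
    ENNReal.ofReal_le_of_le_toReal ((min_le_left _ _).trans (min_le_left _ _))
  have hcc₂ : ENNReal.ofReal c ≤ c₂ :=
    ENNReal.ofReal_le_of_le_toReal ((min_le_left _ _).trans (min_le_right _ _))
  obtain ⟨l, hl⟩ := pow_unbounded_of_one_lt (((1 + L) * D) * ((1 + L) * 3)) (one_lt_two (α := ℝ))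
  obtain ⟨k₀, hk₀⟩ := exists_frostmanPair_few_directions_false hL hD
    (by norm_num : (1 : ℝ) ≤ 9) hc0 (min_le_right _ _) hu1 hu hτ hτs hs l
  obtain ⟨m, hm⟩ := exists_directionCover_lt_dyadicContent (hcov k₀) hc₁X
  obtain ⟨T, hT, ν, hν, hνs, hνb, hνA⟩ := exists_frostman_weight (hτ.trans hτs.le) hA m
  set X' := {x ∈ X | ∃ J, DirectionCover A τ k₀ m x J}
  have hJ : ∀ x ∈ X', ∃ J, DirectionCover A τ k₀ m x J := fun x hx => hx.2
  choose! J hJ using hJ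
  have hνc : c < ∑ z ∈ T, ν z := by
    have h1 := hcc₂.trans_lt (hc₂A.trans_le hνA)
    exact (ENNReal.ofReal_lt_ofReal_iff_of_nonneg hc0.le).1 h1
  obtain ⟨k, hk, hkX⟩ := exists_level_of_directionCover hc0.le hJ hT hν hνc (hcc₁.trans_lt hm)
  rw [Finset.mem_Icc] at hk
  obtain ⟨S, hS, μ, hμ, hμs, hμb, hμX⟩ := exists_frostman_weight (by linarith : (0 : ℝ) ≤ u)
    (fun x hx => hX hx.1.1 : {x ∈ X' | c / ((k : ℝ) + 2) ^ 2 ≤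
      mass T ν (fun y => ∃ P ∈ J x k, y ∈ P)} ⊆ dyadicCube (i, d)) k
  have hSX : (S : Set E2) ⊆ X := fun x hx => (hS hx).1.1
  refine hk₀ k hk.1 (h.frostmanPair hj hSX hT hμ hν hμs hνs hμb
    fun i hi => hνb i (hi.trans hk.2)) ?_ (fun x => J x k) (fun x hx => (hJ x (hS hx).1).1 k) ?_
    fun x hx => (hS hx).2
  · exact (ENNReal.ofReal_le_ofReal_iff (Finset.sum_nonneg fun z _ => hμ z)).1 (hkX.trans hμX)
  · intro x hx P hP y hy z hz hyP hzP
    have h1 := (hJ x (hS hx).1).2.1 k P hP y hyP z hzP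
    have h2 := h.slope_le x (hSX hx) y (hT hy)
    have h3 := h.dist_le hj hL (hSX hx) (hT hz)
    have h4 := dyad_pos 1 k
    calc _ ≤ _ := lineDev_le_dist_radProj (h.ne x (hSX hx) y (hT hy))
      _ ≤ ((1 + L) * D) * ((1 + L) * (3 * dyad 1 k)) := by gcongr
      _ = ((1 + L) * D) * ((1 + L) * 3) * dyad 1 k := by ring
      _ ≤ _ := by gcongr

end visibility

/-! ### Exceptional sets -/

section exceptional

lemma exists_dyadicCube_dyadicContent_pos {s : ℝ} {A : Set E2} (n : ℕ) (h : 0 < dyadicContent s A) :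
    ∃ d, 0 < dyadicContent s (A ∩ dyadicCube (n, d)) := by
  by_contra! hzero
  have hcov : A ⊆ ⋃ d, A ∩ dyadicCube (n, d) := fun z hz => mem_iUnion.2 ⟨dyadicCode n z, hz, rfl⟩
  have h1 := (dyadicContent_mono hcov).trans (dyadicContent_iUnion_le (s := s) _)
  rw [ENNReal.tsum_eq_zero.2 fun d => nonpos_iff_eq_zero.1 (hzero d)] at h1
  exact absurd h (not_lt.2 h1)

lemma exists_infDist_dyadicContent_pos {s : ℝ} {X K : Set E2} (hK : IsCompact K) (hne : K.Nonempty)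
    (hX : ∀ x ∈ X, x ∉ K) (h : 0 < dyadicContent s X) :
    ∃ n, 0 < dyadicContent s {x ∈ X | 8 * dyad 1 n ≤ infDist x K} := by
  by_contra! hzero
  have hcov : X ⊆ ⋃ n, {x ∈ X | 8 * dyad 1 n ≤ infDist x K} := fun x hx => by
    have hpos : 0 < infDist x K / 8 := by
      have := (hK.isClosed.notMem_iff_infDist_pos hne).1 (hX x hx)
      positivity
    obtain ⟨n, hn⟩ := exists_pow_lt_of_lt_one hpos (by norm_num : (1 / 2 : ℝ) < 1)
    refine mem_iUnion.2 ⟨n, hx, ?_⟩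
    rw [dyad_one]
    linarith
  have h1 := (dyadicContent_mono hcov).trans (dyadicContent_iUnion_le (s := s) _)
  rw [ENNReal.tsum_eq_zero.2 fun d => nonpos_iff_eq_zero.1 (hzero d)] at h1
  exact absurd h (not_lt.2 h1)

lemma transversalSets_of_abs_sub_le {j j' : Fin 2} {δ : ℝ} (hδ : 0 < δ) (hδ1 : δ ≤ 1) {x₀ y₀ : E2}
    (hsep : 4 * δ ≤ |y₀ j - x₀ j|) (hmax : |y₀ j' - x₀ j'| ≤ |y₀ j - x₀ j|) {X A : Set E2}
    (hX : ∀ x ∈ X, ∀ z ∈ X, ∀ i, |z i - x i| ≤ δ) (hA : ∀ y ∈ A, ∀ z ∈ A, ∀ i, |z i - y i| ≤ δ)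
    (hx₀ : x₀ ∈ X) (hy₀ : y₀ ∈ A) :
    TransversalSets j j' 3 (|y₀ j - x₀ j| + 2) X A := by
  have key : ∀ x ∈ X, ∀ y ∈ A, ∀ i, |(y i - x i) - (y₀ i - x₀ i)| ≤ 2 * δ := fun x hx y hy i => by
    have h1 := hX x hx x₀ hx₀ i
    have h2 := hA y₀ hy₀ y hy i
    rw [abs_le] at *
    constructor <;> linarith [h1.1, h1.2, h2.1, h2.2]
  have hlow : ∀ x ∈ X, ∀ y ∈ A, |y₀ j - x₀ j| / 2 ≤ |y j - x j| := fun x hx y hy => by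
    have h1 := abs_sub_abs_le_abs_sub (y₀ j - x₀ j) (y j - x j)
    rw [abs_sub_comm (y₀ j - x₀ j)] at h1
    linarith [key x hx y hy j]
  have hup : ∀ x ∈ X, ∀ y ∈ A, ∀ i, |y i - x i| ≤ |y₀ i - x₀ i| + 2 * δ := fun x hx y hy i => by
    have h1 := abs_sub_abs_le_abs_sub (y i - x i) (y₀ i - x₀ i)
    linarith [key x hx y hy i]
  constructor
  · intro x hx y hy h
    have := hlow x hx y hy
    rw [h, sub_self, abs_zero] at this
    linarith
  · intro x hx y hy
    have h1 := hlow x hx y hy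
    rw [lineSlope, abs_div, div_le_iff₀ (by linarith)]
    linarith [hup x hx y hy j']
  · intro x hx z hz
    linarith [hX x hx z hz j, abs_nonneg (y₀ j - x₀ j)]
  · intro x hx y hy
    linarith [hup x hx y hy j]

/-- From almost no point outside a set of positive `s`-dimensional content, in the sense of
`u`-dimensional content with `u > 1`, does it have fewer than `s`-dimensional directions. -/
theorem dyadicContent_exceptional_eq_zero {K : Set E2} (hK : IsCompact K) {τ : ℝ≥0} {s u : ℝ}
    (hτs : τ < s) (hs : s < 1) (hu1 : 1 < u) (hu : u ≤ 2) (hpos : 0 < dyadicContent s K)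
    {X : Set E2} (hXK : ∀ x ∈ X, x ∉ K) (hX : ∀ x ∈ X, dimH (radProj x '' K) < τ) :
    dyadicContent u X = 0 := by
  by_contra hne
  have hempty : ∀ {v : ℝ} {A : Set E2}, 0 < dyadicContent v A → A.Nonempty := fun {v A} h => by
    by_contra hA
    rw [not_nonempty_iff_eq_empty.1 hA, dyadicContent_empty] at h
    exact lt_irrefl _ h
  obtain ⟨n, hn⟩ := exists_infDist_dyadicContent_pos hK (hempty hpos) hXK (pos_iff_ne_zero.2 hne)
  obtain ⟨d, hd⟩ := exists_dyadicCube_dyadicContent_pos n hn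
  obtain ⟨d', hd'⟩ := exists_dyadicCube_dyadicContent_pos n hpos
  obtain ⟨x₀, hx₀⟩ := hempty hd
  obtain ⟨y₀, hy₀⟩ := hempty hd'
  have hcube : ∀ {e : ℤ × ℤ} {B : Set E2}, ∀ x ∈ B ∩ dyadicCube (n, e), ∀ z ∈ B ∩ dyadicCube (n, e),
      ∀ i, |z i - x i| ≤ dyad 1 n := fun x hx z hz i => by
    have := abs_sub_le_of_code_eq (Eq.trans hz.2 (Eq.symm hx.2))
    fin_cases i
    exacts [this.1, this.2]
  have hdist : 8 * dyad 1 n ≤ |y₀ 0 - x₀ 0| + |y₀ 1 - x₀ 1| := by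
    refine hx₀.1.2.trans ((infDist_le_dist_of_mem hy₀.1).trans ?_)
    rw [dist_comm]
    exact dist_le_abs_add_abs y₀ x₀
  have hmax : ∃ j j' : Fin 2, j ≠ j' ∧ 4 * dyad 1 n ≤ |y₀ j - x₀ j| ∧
      |y₀ j' - x₀ j'| ≤ |y₀ j - x₀ j| := by
    rcases le_total |y₀ 0 - x₀ 0| |y₀ 1 - x₀ 1| with h | h
    · exact ⟨1, 0, by decide, by linarith, h⟩
    · exact ⟨0, 1, by decide, by linarith, h⟩
  obtain ⟨j, j', hj, hsep, hle⟩ := hmax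
  have htr := transversalSets_of_abs_sub_le (dyad_pos 1 n) (dyad_le_one zero_le_one n) hsep hle
    hcube hcube hx₀ hy₀
  refine hd.ne' (htr.dyadicContent_eq_zero hj (by norm_num)
    (by linarith [abs_nonneg (y₀ j - x₀ j)]) τ.2 hτs hs hu1 hu inter_subset_right
    inter_subset_right (fun k₀ x hx => ?_) hd')
  obtain ⟨m, J, hJ⟩ := exists_directionCover hK (hXK x hx.1.1) (hX x hx.1.1) k₀
  exact ⟨m, J, hJ.mono inter_subset_left le_rfl⟩

/-- The points from which `Y` has fewer than `q`-dimensional directions, for a fixed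
`q < dimH Y`. -/
lemma dimH_radProj_lt_le_one {Y : Set E2} (hYm : MeasurableSet Y) (hY : dimH Y ≤ 1) {q : ℝ≥0}
    (hq : (q : ℝ≥0∞) < dimH Y) : dimH {x : E2 | x ∉ Y ∧ dimH (radProj x '' Y) < q} ≤ 1 := by
  by_contra! hlt
  obtain ⟨s, hqs, hsY⟩ := ENNReal.lt_iff_exists_nnreal_btwn.1 hq
  obtain ⟨u, hu1, huX⟩ := ENNReal.lt_iff_exists_nnreal_btwn.1
    (lt_min hlt (by norm_num : (1 : ℝ≥0∞) < 2))
  have hqs' : q < s := by exact_mod_cast hqs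
  have hs1 : s < 1 := by exact_mod_cast hsY.trans_le hY
  have hu1' : 1 < u := by exact_mod_cast hu1
  have hu2 : u < 2 := by exact_mod_cast huX.trans_le (min_le_right _ _)
  obtain ⟨K, hKY, hK, hKpos⟩ := exists_isCompact_dyadicContent_pos hYm.analyticSet
    (dyadicContent_pos_of_lt_dimH ((zero_le).trans_lt hqs') hsY)
  have hXpos := dyadicContent_pos_of_lt_dimH (zero_lt_one.trans hu1')
    (huX.trans_le (min_le_left _ _))
  exact hXpos.ne' (dyadicContent_exceptional_eq_zero hK (NNReal.coe_lt_coe.2 hqs')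
    (by exact_mod_cast hs1) (by exact_mod_cast hu1') (by exact_mod_cast hu2.le) hKpos
    (fun x hx hxK => hx.1 (hKY hxK))
    fun x hx => (dimH_mono (image_mono hKY)).trans_lt hx.2)

end exceptional

/-- If `Y ⊆ ℝ²` is Borel with `dim_H Y ≤ 1`, then
`{x ∈ ℝ² \ Y : dim_H π_x(Y) < dim_H Y}` has Hausdorff dimension at most `1`. -/
theorem exceptional_set_dim_le_one (Y : Set E2) (hYm : MeasurableSet Y)
    (hY : dimH Y ≤ 1) :
    dimH {x : E2 | x ∉ Y ∧ dimH (radProj x '' Y) < dimH Y} ≤ 1 := by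
  have hcov : {x : E2 | x ∉ Y ∧ dimH (radProj x '' Y) < dimH Y} ⊆
      ⋃ q ∈ {q : ℚ | ((q : ℝ).toNNReal : ℝ≥0∞) < dimH Y},
        {x : E2 | x ∉ Y ∧ dimH (radProj x '' Y) < (q : ℝ).toNNReal} := fun x hx => by
    obtain ⟨q, -, hxq, hqY⟩ := ENNReal.lt_iff_exists_rat_btwn.1 hx.2
    exact mem_iUnion₂.2 ⟨q, hqY, hx.1, hxq⟩
  refine (dimH_mono hcov).trans ?_
  rw [dimH_bUnion (to_countable _)]
  exact iSup₂_le fun q hq => dimH_radProj_lt_le_one hYm hY hq
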